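/- For every k ≥ 1: (i) for every finite 2k-edge-connected undirected graph G and every node t ∈ V, there exist 2k pairwise arc-disjoint arborescences T_1,…,T_{2k} of G rooted at t such that T_1,…,T_k are pairwise edge-disjoint and T_{k+1},…,T_{2k} are pairwise edge-disjoint; and (ii) for every finite (2k+1)-edge-connected undirected graph G and every node t ∈ V, there exist 2k+1 pairwise arc-disjoint arborescences T_1,…,T_{2k+1} of G rooted at t such that T_1,…,T_k are pairwise edge-disjoint and T_{k+1},…,T_{2k} are pairwise edge-disjoint. -/

import Mathlib

set_option linter.unusedSectionVars false
namespace ArbPack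
open scoped Classical

/-! ### Edmonds' theorem on disjoint arborescences (cut version) -/

noncomputable def outN {V A : Type*} [Fintype A] (src dst : A → V) (S : Set A) (X : Set V) : ℕ :=
  ∑ a, if src a ∈ X ∧ dst a ∉ X ∧ a ∈ S then 1 else 0

theorem outN_submod {V A : Type*} [Fintype A] (src dst : A → V) (S : Set A) (X Y : Set V) :
    outN src dst S (X ∩ Y) + outN src dst S (X ∪ Y) ≤ outN src dst S X + outN src dst S Y := by
  unfold outN
  rw [← Finset.sum_add_distrib, ← Finset.sum_add_distrib]
  refine Finset.sum_le_sum fun a _ => ?_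
  by_cases h1 : src a ∈ X <;> by_cases h2 : src a ∈ Y <;> by_cases h3 : dst a ∈ X <;>
    by_cases h4 : dst a ∈ Y <;> by_cases h5 : a ∈ S <;> simp [h1, h2, h3, h4, h5]

theorem exists_of_outN_lt {V A : Type*} [Fintype A] {src dst : A → V} {S S' : Set A} {X Y : Set V}
    (h : outN src dst S X < outN src dst S' Y) :
    ∃ a, (src a ∈ Y ∧ dst a ∉ Y ∧ a ∈ S') ∧ ¬ (src a ∈ X ∧ dst a ∉ X ∧ a ∈ S) := by
  by_contra! hc
  refine absurd h (not_lt.2 (Finset.sum_le_sum fun a _ => ?_))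
  have := hc a
  split_ifs with h1 h2
  · exact le_rfl
  · exact absurd (this h1) h2
  · simp
  · simp

theorem outN_insert_le {V A : Type*} [Fintype A] {src dst : A → V} {S T : Set A} {X : Set V} (a : A) :
    outN src dst (S \ T) X ≤ outN src dst (S \ insert a T) X + 1 := by
  unfold outN
  have : (1:ℕ) = ∑ x : A, if x = a then 1 else 0 := by simp
  rw [this, ← Finset.sum_add_distrib]
  refine Finset.sum_le_sum fun x _ => ?_
  by_cases hx : x = a <;> simp [hx]
  split_ifs <;> simp

theorem outN_insert_eq {V A : Type*} [Fintype A] {src dst : A → V} {S T : Set A} {X : Set V} (a : A)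
    (h : ¬ (src a ∈ X ∧ dst a ∉ X)) :
    outN src dst (S \ T) X ≤ outN src dst (S \ insert a T) X := by
  unfold outN
  refine Finset.sum_le_sum fun x _ => ?_
  by_cases hx : x = a
  · subst hx
    rw [if_neg]
    · simp
    · tauto
  · simp [hx]

theorem peel_aux {V A : Type*} [Fintype V] [Fintype A] (src dst : A → V) (S : Set A) (t : V) (k : ℕ)
    (hS : ∀ X : Set V, t ∉ X → X.Nonempty → k + 1 ≤ outN src dst S X) :
    ∀ (n : ℕ) (W : Set V) (T : Set A) (par : V → V) (r : V → ℕ), Wᶜ.ncard ≤ n → t ∈ W → T ⊆ S →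
      (∀ a ∈ T, src a ∈ W) →
      (∀ v ∈ W, v ≠ t → ∃ a ∈ T, src a = v ∧ dst a = par v) →
      (∀ v ∈ W, v ≠ t → par v ∈ W ∧ r (par v) < r v) →
      (∀ X : Set V, t ∉ X → X.Nonempty → k ≤ outN src dst (S \ T) X) →
      ∃ (par : V → V) (T : Set A), T ⊆ S ∧ (∀ v, v ≠ t → ∃ a ∈ T, src a = v ∧ dst a = par v) ∧
        (∀ v, ∃ n : ℕ, par^[n] v = t) ∧
        (∀ X : Set V, t ∉ X → X.Nonempty → k ≤ outN src dst (S \ T) X) := by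
  intro n
  induction n with
  | zero =>
    intro W T par r hW htW hTS hT h1 h2 h3
    have hWu : ∀ v, v ∈ W := by
      have : Wᶜ = ∅ := by
        rw [← Set.ncard_eq_zero (Set.toFinite _)]; omega
      intro v
      by_contra hv
      have : v ∈ (∅ : Set V) := this ▸ hv
      simp at this
    refine ⟨par, T, hTS, fun v hv => h1 v (hWu v) hv, ?_, h3⟩
    have key : ∀ m v, r v ≤ m → ∃ n : ℕ, par^[n] v = t := by
      intro m
      induction m with
      | zero =>
        intro v hv
        by_cases hvt : v = t
        · exact ⟨0, hvt⟩
        · have := (h2 v (hWu v) hvt).2; omega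
      | succ m ih =>
        intro v hv
        by_cases hvt : v = t
        · exact ⟨0, hvt⟩
        · have := (h2 v (hWu v) hvt).2
          obtain ⟨n, hn⟩ := ih (par v) (by omega)
          exact ⟨n + 1, by simpa [Function.iterate_succ_apply] using hn⟩
    exact fun v => key _ v le_rfl
  | succ n ih =>
    intro W T par r hW htW hTS hT h1 h2 h3
    by_cases hne : Wᶜ.Nonempty
    swap
    · refine ih W T par r ?_ htW hTS hT h1 h2 h3
      rw [Set.not_nonempty_iff_eq_empty.1 hne]; simp
    have hout : ∀ X : Set V, t ∉ X → X.Nonempty → (∀ x ∈ X, x ∉ W) → k + 1 ≤ outN src dst (S \ T) X := by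
      intro X ht hX hXW
      refine (hS X ht hX).trans (Finset.sum_le_sum fun a _ => ?_)
      by_cases ha : src a ∈ X
      · have : a ∉ T := fun h => hXW _ ha (hT a h)
        simp [ha, this]
      · simp [ha]
    -- find the arc
    have harc : ∃ a, a ∈ S \ T ∧ src a ∉ W ∧ dst a ∈ W ∧
        ∀ Y : Set V, t ∉ Y → src a ∈ Y → dst a ∉ Y → k + 1 ≤ outN src dst (S \ T) Y := by
      by_cases hex : ∃ X : Set V, t ∉ X ∧ (∃ x ∈ X, x ∉ W) ∧ outN src dst (S \ T) X ≤ k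
      · obtain ⟨X, hX⟩ := exists_minimal_of_wellFoundedLT
          (fun X : Set V => t ∉ X ∧ (∃ x ∈ X, x ∉ W) ∧ outN src dst (S \ T) X ≤ k) hex
        obtain ⟨⟨htX, ⟨x, hxX, hxW⟩, hXk⟩, hmin⟩ := hX
        have := hout (X \ W) (fun h => htX h.1) ⟨x, hxX, hxW⟩ (fun x hx => hx.2)
        obtain ⟨a, ⟨ha1, ha2, ha3⟩, ha4⟩ := exists_of_outN_lt (lt_of_le_of_lt hXk this)
        have hdX : dst a ∈ X := by
          by_contra hh; exact ha4 ⟨ha1.1, hh, ha3⟩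
        have hdW : dst a ∈ W := by
          by_contra hh; exact ha2 ⟨hdX, hh⟩
        refine ⟨a, ha3, ha1.2, hdW, ?_⟩
        intro Y htY haY hdY
        by_contra hlt
        have hs := outN_submod src dst (S \ T) X Y
        have hu := h3 (X ∪ Y) (by simp [htX, htY]) ⟨x, Or.inl hxX⟩
        have := hmin (y := X ∩ Y) ⟨fun h => htX h.1, ⟨src a, ⟨ha1.1, haY⟩, ha1.2⟩, by omega⟩
          (fun z hz => hz.1)
        exact hdY (this hdX).2
      · push Not at hex
        have := hout Wᶜ (by simpa using htW) hne (fun x hx => hx)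
        have h0 : outN src dst ∅ (∅ : Set V) < outN src dst (S \ T) Wᶜ := by
          have e0 : outN src dst ∅ (∅ : Set V) = 0 := by simp [outN]
          omega
        obtain ⟨a, ⟨ha1, ha2, ha3⟩, ha4⟩ := exists_of_outN_lt h0
        refine ⟨a, ha3, ha1, by simpa using ha2, ?_⟩
        intro Y htY haY hdY
        exact hex Y htY ⟨src a, haY, ha1⟩
    obtain ⟨a, haST, haW, hdW, hres⟩ := harc
    have hne' : ∀ v ∈ W, v ≠ src a := fun v hv h => haW (h ▸ hv)
    refine ih (insert (src a) W) (insert a T) (Function.update par (src a) (dst a))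
      (Function.update r (src a) (r (dst a) + 1)) ?_ (Or.inr htW) ?_ ?_ ?_ ?_ ?_
    · have : (insert (src a) W)ᶜ ⊂ Wᶜ := by
        refine ⟨fun z hz => fun h => hz (Or.inr h), fun h => ?_⟩
        have := h (show src a ∈ Wᶜ from haW)
        exact this (Or.inl rfl)
      have := Set.ncard_lt_ncard this (Set.toFinite _)
      omega
    · rintro x (rfl | hx)
      · exact haST.1
      · exact hTS hx
    · rintro x (rfl | hx)
      · exact Or.inl rfl
      · exact Or.inr (hT x hx)
    · rintro v (rfl | hv) hvt
      · exact ⟨a, Or.inl rfl, rfl, by simp⟩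
      · obtain ⟨a', ha', h⟩ := h1 v hv hvt
        exact ⟨a', Or.inr ha', h.1, by rw [Function.update_of_ne (hne' v hv)]; exact h.2⟩
    · rintro v (rfl | hv) hvt
      · have := hne' _ hdW
        simp [hdW, this]
      · obtain ⟨h4, h5⟩ := h2 v hv hvt
        rw [Function.update_of_ne (hne' v hv), Function.update_of_ne (hne' v hv),
          Function.update_of_ne (hne' _ h4)]
        exact ⟨Or.inr h4, h5⟩
    · intro X htX hX
      by_cases hc : src a ∈ X ∧ dst a ∉ X
      · have := hres X htX hc.1 hc.2
        have := outN_insert_le (src := src) (dst := dst) (S := S) (T := T) (X := X) a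
        omega
      · exact (h3 X htX hX).trans (outN_insert_eq a hc)

theorem edmonds {V A : Type*} [Fintype V] [Fintype A] (src dst : A → V) (t : V) (k : ℕ) :
    ∀ (S : Set A), (∀ X : Set V, t ∉ X → X.Nonempty → k ≤ outN src dst S X) →
    ∃ (par : Fin k → V → V) (T : Fin k → Set A), (∀ i, T i ⊆ S) ∧
      (∀ i v, v ≠ t → ∃ a ∈ T i, src a = v ∧ dst a = par i v) ∧
      (∀ i v, ∃ n : ℕ, (par i)^[n] v = t) ∧ (∀ i j, i ≠ j → ∀ a ∈ T i, a ∉ T j) := by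
  induction k with
  | zero => exact fun S _ => ⟨fun i => i.elim0, fun i => i.elim0, fun i => i.elim0, fun i => i.elim0,
      fun i => i.elim0, fun i => i.elim0⟩
  | succ k ih =>
    intro S hS
    obtain ⟨par, T, h1, h2, h3, h4⟩ := peel_aux src dst S t k hS _ {t} ∅ id (fun _ => 0) le_rfl rfl
      (by simp) (by simp) (by simp) (by simp)
      (fun X h h' => by simpa using (Nat.le_succ k).trans (hS X h h'))
    obtain ⟨par', T', g1, g2, g3, g4⟩ := ih _ h4
    refine ⟨Fin.cons par par', Fin.cons T T', ?_, ?_, ?_, ?_⟩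
    · intro i
      refine Fin.cases ?_ (fun i => ?_) i
      · simpa using h1
      · simpa using (g1 i).trans Set.sdiff_subset
    · intro i
      refine Fin.cases ?_ (fun i => ?_) i
      · simpa using h2
      · simpa using g2 i
    · intro i
      refine Fin.cases ?_ (fun i => ?_) i
      · simpa using h3
      · simpa using g3 i
    · intro i j
      refine Fin.cases ?_ (fun i => ?_) i <;> refine Fin.cases ?_ (fun j => ?_) j
      · simp
      · intro _ a ha hb
        exact (g1 j hb).2 ha
      · intro _ a ha hb
        exact (g1 i ha).2 hb
      · intro h a
        simpa using g4 i j (fun h' => h (by rw [h'])) a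

/-! ### Graphs as maps `s : E → Bool → V` (the two ends of each edge) -/

/-- The arc `(e, b)` of the bidirected graph leaves `X`. -/
def lv {V E : Type*} (s : E → Bool → V) (X : Set V) (e : E) (b : Bool) : Prop :=
  s e b ∈ X ∧ s e (!b) ∉ X

noncomputable def oC {V E : Type*} [Fintype E] (s : E → Bool → V) (C : Set (E × Bool)) (X : Set V)
    (b : Bool) : ℕ := ∑ e, if lv s X e b ∧ (e, b) ∉ C then 1 else 0

noncomputable def dg {V E : Type*} [Fintype E] (s : E → Bool → V) (X : Set V) : ℕ :=
  ∑ e, if (s e true ∈ X ↔ s e false ∈ X) then 0 else 1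

noncomputable def nl {V E : Type*} [Fintype E] (s : E → Bool → V) : ℕ :=
  ∑ e, if s e true = s e false then 0 else 1

def Conn {V E : Type*} [Fintype E] (s : E → Bool → V) (R : Set V) (K : ℕ) : Prop :=
  ∀ X : Set V, (∃ x ∈ X, x ∈ R) → (∃ x ∈ R, x ∉ X) → K ≤ dg s X

def Supp {V E : Type*} (s : E → Bool → V) (R : Set V) : Prop :=
  ∀ e, s e true = s e false ∨ ∀ b, s e b ∈ R

def Bal {V E : Type*} [Fintype E] (s : E → Bool → V) (v : V) : Prop :=
  (∑ e, if s e true = v then 1 else 0) = ∑ e, if s e false = v then 1 else 0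

def Eqv {V E : Type*} (s s' : E → Bool → V) : Prop :=
  ∀ e, (∀ b, s' e b = s e b) ∨ (∀ b, s' e b = s e (!b))

structure Sol {V E : Type*} [Fintype E] (odd : Prop) (t : V) (k : ℕ) (s : E → Bool → V)
    (C : Set (E × Bool)) (R : Set V) : Prop where
  cut : ∀ X : Set V, t ∉ X → (∃ x ∈ X, x ∈ R) → ∀ b, k ≤ oC s C X b
  conn : odd → ∀ X : Set V, t ∉ X → (∃ x ∈ X, x ∈ R) → ∃ e b, (e, b) ∈ C ∧ lv s X e b

section basic
variable {V E : Type*} [Fintype E] {s s' : E → Bool → V} {X Y R : Set V} {C C' : Set (E × Bool)}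

theorem sum_le_one {F G : E → ℕ} (e : E) (h : ∀ g, g ≠ e → F g ≤ G g) (he : F e ≤ G e) :
    ∑ g, F g ≤ ∑ g, G g :=
  Finset.sum_le_sum fun g _ => by
    by_cases hg : g = e
    · rw [hg]; exact he
    · exact h g hg

theorem sum_le_two {F G : E → ℕ} {e f : E} (hef : e ≠ f) (h : ∀ g, g ≠ e → g ≠ f → F g ≤ G g)
    (he : F e + F f ≤ G e + G f) : ∑ g, F g ≤ ∑ g, G g := by
  rw [← Finset.add_sum_erase _ F (Finset.mem_univ e), ← Finset.add_sum_erase _ G (Finset.mem_univ e),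
    ← Finset.add_sum_erase _ F (Finset.mem_erase.2 ⟨hef.symm, Finset.mem_univ f⟩),
    ← Finset.add_sum_erase _ G (Finset.mem_erase.2 ⟨hef.symm, Finset.mem_univ f⟩)]
  have : ∑ x ∈ (Finset.univ.erase e).erase f, F x ≤ ∑ x ∈ (Finset.univ.erase e).erase f, G x := by
    refine Finset.sum_le_sum fun g hg => ?_
    simp at hg
    exact h g hg.2 hg.1
  omega

theorem sum_eq_two {F G : E → ℕ} {e f : E} (hef : e ≠ f) (h : ∀ g, g ≠ e → g ≠ f → F g = G g)
    (he : F e + F f = G e + G f) : ∑ g, F g = ∑ g, G g :=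
  le_antisymm (sum_le_two hef (fun g h1 h2 => (h g h1 h2).le) he.le)
    (sum_le_two hef (fun g h1 h2 => (h g h1 h2).ge) he.ge)

/-- Change at a single edge. -/
theorem sum_add_one {F G : E → ℕ} (e : E) (h : ∀ g, g ≠ e → F g = G g) :
    (∑ g, F g) + G e = (∑ g, G g) + F e := by
  rw [← Finset.add_sum_erase _ F (Finset.mem_univ e), ← Finset.add_sum_erase _ G (Finset.mem_univ e)]
  have : ∑ x ∈ Finset.univ.erase e, F x = ∑ x ∈ Finset.univ.erase e, G x := by
    refine Finset.sum_congr rfl fun g hg => ?_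
    simp at hg
    exact h g hg
  omega

theorem dg_eq (s : E → Bool → V) (X : Set V) : dg s X = oC s ∅ X true + oC s ∅ X false := by
  unfold dg oC lv
  rw [← Finset.sum_add_distrib]
  refine Finset.sum_congr rfl fun e _ => ?_
  by_cases h1 : s e true ∈ X <;> by_cases h2 : s e false ∈ X <;> simp [h1, h2]

theorem dg_compl (s : E → Bool → V) (X : Set V) : dg s Xᶜ = dg s X := by
  unfold dg
  refine Finset.sum_congr rfl fun e _ => ?_
  by_cases h1 : s e true ∈ X <;> by_cases h2 : s e false ∈ X <;> simp [h1, h2]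

theorem dg_submod (s : E → Bool → V) (X Y : Set V) :
    dg s (X ∩ Y) + dg s (X ∪ Y) ≤ dg s X + dg s Y := by
  unfold dg
  rw [← Finset.sum_add_distrib, ← Finset.sum_add_distrib]
  refine Finset.sum_le_sum fun e _ => ?_
  by_cases h1 : s e true ∈ X <;> by_cases h2 : s e false ∈ X <;> by_cases h3 : s e true ∈ Y <;>
    by_cases h4 : s e false ∈ Y <;> simp [h1, h2, h3, h4]

theorem dg_diff (s : E → Bool → V) (X Y : Set V) :
    dg s (X \ Y) + dg s (Y \ X) ≤ dg s X + dg s Y := by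
  unfold dg
  rw [← Finset.sum_add_distrib, ← Finset.sum_add_distrib]
  refine Finset.sum_le_sum fun e _ => ?_
  by_cases h1 : s e true ∈ X <;> by_cases h2 : s e false ∈ X <;> by_cases h3 : s e true ∈ Y <;>
    by_cases h4 : s e false ∈ Y <;> simp [h1, h2, h3, h4]

/-- For disjoint sets, `d X + d Y = d (X ∪ Y) + 2 d (X, Y)`. -/
theorem dg_disj (s : E → Bool → V) (X Y : Set V) (h : ∀ x ∈ X, x ∉ Y) :
    dg s X + dg s Y = dg s (X ∪ Y) +
      2 * ∑ e, if (∃ b, s e b ∈ X ∧ s e (!b) ∈ Y) then 1 else 0 := by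
  unfold dg
  rw [Finset.mul_sum, ← Finset.sum_add_distrib, ← Finset.sum_add_distrib]
  refine Finset.sum_congr rfl fun e _ => ?_
  have ht := h (s e true)
  have hf := h (s e false)
  by_cases h1 : s e true ∈ X <;> by_cases h2 : s e false ∈ X <;> by_cases h3 : s e true ∈ Y <;>
    by_cases h4 : s e false ∈ Y <;> simp_all

theorem lv_supp (h : Supp s R) (e : E) (b : Bool) : lv s X e b ↔ lv s (X ∩ R) e b := by
  unfold lv
  rcases h e with h | h
  · cases b <;> simp [h]
  · simp [h]

theorem oC_supp (h : Supp s R) (C : Set (E × Bool)) (b : Bool) : oC s C X b = oC s C (X ∩ R) b := by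
  unfold oC
  refine Finset.sum_congr rfl fun e _ => ?_
  rw [lv_supp h]

theorem dg_supp (h : Supp s R) : dg s X = dg s (X ∩ R) := by
  rw [dg_eq, dg_eq, ← oC_supp h, ← oC_supp h]

theorem Supp.mono {R' : Set V} (h : Supp s R) (hR : R ⊆ R') : Supp s R' :=
  fun e => (h e).imp id (fun h b => hR (h b))

theorem Conn.mono {R' : Set V} {K : ℕ} (h : Conn s R K) (hR : R' ⊆ R) : Conn s R' K :=
  fun X ⟨x, hx, hx'⟩ ⟨y, hy, hy'⟩ => h X ⟨x, hx, hR hx'⟩ ⟨y, hR hy, hy'⟩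

theorem oC_anti (h : ∀ e b, lv s X e b → (e, b) ∈ C' → (e, b) ∈ C) (b : Bool) :
    oC s C X b ≤ oC s C' X b := by
  unfold oC
  refine Finset.sum_le_sum fun e _ => ?_
  split_ifs with h1 h2
  · exact le_rfl
  · exact absurd ⟨h1.1, fun hh => h1.2 (h e b h1.1 hh)⟩ h2
  · simp
  · simp

theorem oC_zero_le (b : Bool) : oC s C X b ≤ oC s ∅ X b := oC_anti (by simp) b

/-- If at most one arc of `C` of class `b` leaves `X`, only one is lost. -/
theorem oC_lose_one {b : Bool} (f : E) (h : ∀ e, lv s X e b → (e, b) ∈ C → e = f) :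
    oC s ∅ X b ≤ oC s C X b + 1 := by
  unfold oC
  have : (1:ℕ) = ∑ x : E, if x = f then 1 else 0 := by simp
  rw [this, ← Finset.sum_add_distrib]
  refine Finset.sum_le_sum fun e _ => ?_
  have := h e
  by_cases h1 : lv s X e b <;> by_cases h2 : (e, b) ∈ C <;> simp_all

theorem oC_lose_none {b : Bool} (h : ∀ e, lv s X e b → (e, b) ∉ C) :
    oC s ∅ X b ≤ oC s C X b := by
  unfold oC
  refine Finset.sum_le_sum fun e _ => ?_
  have := h e
  by_cases h1 : lv s X e b <;> simp_all

theorem oC_submod (s : E → Bool → V) (C : Set (E × Bool)) (b : Bool) (X Y : Set V) :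
    oC s C (X ∩ Y) b + oC s C (X ∪ Y) b ≤ oC s C X b + oC s C Y b := by
  unfold oC lv
  rw [← Finset.sum_add_distrib, ← Finset.sum_add_distrib]
  refine Finset.sum_le_sum fun e _ => ?_
  by_cases h1 : s e b ∈ X <;> by_cases h2 : s e (!b) ∈ X <;> by_cases h3 : s e b ∈ Y <;>
    by_cases h4 : s e (!b) ∈ Y <;> by_cases h5 : (e, b) ∈ C <;> simp [h1, h2, h3, h4, h5]

theorem Eqv.refl (s : E → Bool → V) : Eqv s s := fun _ => Or.inl fun _ => rfl

theorem Eqv.symm (h : Eqv s s') : Eqv s' s := fun e => by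
  rcases h e with h | h
  · exact Or.inl fun b => (h b).symm
  · exact Or.inr fun b => by simp [h]

theorem Eqv.dg (h : Eqv s s') (X : Set V) : dg s X = dg s' X := by
  unfold ArbPack.dg
  refine Finset.sum_congr rfl fun e _ => ?_
  rcases h e with h | h
  · simp [h]
  · simp [h, Iff.comm]

theorem Eqv.supp (h : Eqv s s') (hs : Supp s R) : Supp s' R := fun e => by
  rcases h e with h | h
  · simpa [h] using hs e
  · have := hs e
    simp [h] at this ⊢
    tauto

theorem Bal_of_supp (h : Supp s R) {v : V} (hv : v ∉ R) : Bal s v := by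
  unfold Bal
  refine Finset.sum_congr rfl fun e _ => ?_
  rcases h e with h | h
  · rw [h]
  · rw [if_neg, if_neg]
    · intro hh; exact hv (hh ▸ h false)
    · intro hh; exact hv (hh ▸ h true)

/-- Balanced sets. -/
theorem Bal.single {v : V} (h : Bal s v) : oC s ∅ {v} true = oC s ∅ {v} false := by
  have key : ∀ b, (∑ e, if s e b = v then 1 else 0) =
      oC s ∅ {v} b + ∑ e, if s e true = v ∧ s e false = v then 1 else 0 := by
    intro b
    unfold oC lv
    rw [← Finset.sum_add_distrib]
    refine Finset.sum_congr rfl fun e _ => ?_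
    cases b <;> by_cases h1 : s e true = v <;> by_cases h2 : s e false = v <;> simp [h1, h2]
  have h1 := key true
  have h2 := key false
  unfold Bal at h
  omega

theorem Bal.pair {u v : V} (hu : Bal s u) (hv : Bal s v) (huv : u ≠ v) :
    oC s ∅ {u, v} true = oC s ∅ {u, v} false := by
  have key : ∀ b, (∑ e, if s e b = u then 1 else 0) + (∑ e, if s e b = v then 1 else 0) =
      oC s ∅ {u, v} b + ∑ e, if (s e true = u ∨ s e true = v) ∧ (s e false = u ∨ s e false = v)
        then 1 else 0 := by
    intro b
    unfold oC lv
    rw [← Finset.sum_add_distrib, ← Finset.sum_add_distrib]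
    refine Finset.sum_congr rfl fun e _ => ?_
    cases b <;> by_cases h1 : s e true = v <;> by_cases h2 : s e false = v <;>
     by_cases h3 : s e true = u <;> by_cases h4 : s e false = u <;> simp_all
  have h1 := key true
  have h2 := key false
  unfold Bal at hu hv
  omega

end basic

/-! ### Splitting off (Lovász) -/

section splitting
variable {V E : Type*} [Fintype V] [Fintype E] {s s' : E → Bool → V} {X Y R : Set V}

noncomputable def split (s : E → Bool → V) (e f : E) (b₁ b₂ : Bool) : E → Bool → V := fun g b =>
  if g = e then (if b = b₁ then s f (!b₂) else s e b) else if g = f then s f b₂ else s g b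

theorem sum_add_two {F G : E → ℕ} {e f : E} (hef : e ≠ f) (h : ∀ g, g ≠ e → g ≠ f → F g = G g) :
    (∑ g, F g) + (G e + G f) = (∑ g, G g) + (F e + F f) := by
  rw [← Finset.add_sum_erase _ F (Finset.mem_univ e), ← Finset.add_sum_erase _ G (Finset.mem_univ e),
    ← Finset.add_sum_erase _ F (Finset.mem_erase.2 ⟨hef.symm, Finset.mem_univ f⟩),
    ← Finset.add_sum_erase _ G (Finset.mem_erase.2 ⟨hef.symm, Finset.mem_univ f⟩)]
  have : ∑ x ∈ (Finset.univ.erase e).erase f, F x = ∑ x ∈ (Finset.univ.erase e).erase f, G x := by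
    refine Finset.sum_congr rfl fun g hg => ?_
    simp at hg
    exact h g hg.2 hg.1
  omega

theorem dg_split {e f : E} {b₁ b₂ : Bool} {u : V} (hef : e ≠ f) (he : s e b₁ = u) (hf : s f b₂ = u)
    (hu : u ∉ X) :
    dg s X = dg (split s e f b₁ b₂) X + (if s e (!b₁) ∈ X ∧ s f (!b₂) ∈ X then 2 else 0) := by
  have := sum_add_two (F := fun g => if (s g true ∈ X ↔ s g false ∈ X) then 0 else 1)
    (G := fun g => if (split s e f b₁ b₂ g true ∈ X ↔ split s e f b₁ b₂ g false ∈ X) then 0 else 1)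
    hef (by intro g h1 h2; simp [split, h1, h2])
  unfold dg
  have hfe := hef.symm
  subst he
  cases b₁ <;> cases b₂ <;> by_cases h1 : s e true ∈ X <;> by_cases h2 : s e false ∈ X <;>
    by_cases h3 : s f true ∈ X <;> by_cases h4 : s f false ∈ X <;>
    simp_all [split]

theorem nl_split {e f : E} {b₁ b₂ : Bool} {u : V} (hef : e ≠ f) (he : s e b₁ = u)
    (he' : s e (!b₁) ≠ u) (hf : s f b₂ = u) (hf' : s f (!b₂) ≠ u) :
    nl (split s e f b₁ b₂) < nl s := by
  have := sum_add_two (F := fun g => if s g true = s g false then 0 else 1)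
    (G := fun g => if split s e f b₁ b₂ g true = split s e f b₁ b₂ g false then 0 else 1)
    hef (by intro g h1 h2; simp [split, h1, h2])
  unfold nl
  have h1 : (if s e true = s e false then 0 else 1) = 1 := by
    rw [if_neg]; intro h; cases b₁ <;> simp_all
  have h2 : (if s f true = s f false then 0 else 1) = 1 := by
    rw [if_neg]; intro h; cases b₂ <;> simp_all
  have h3 : (if split s e f b₁ b₂ f true = split s e f b₁ b₂ f false then 0 else 1) = 0 := by
    simp [split, hef.symm]
  have h4 : (if split s e f b₁ b₂ e true = split s e f b₁ b₂ e false then 0 else 1) ≤ 1 := by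
    split_ifs <;> simp
  simp only [h1, h2, h3] at this
  omega

theorem supp_split {e f : E} {b₁ b₂ : Bool} {u : V} (he : s e b₁ = u)
    (he' : s e (!b₁) ≠ u) (hf : s f b₂ = u) (hf' : s f (!b₂) ≠ u) (h : Supp s R) :
    Supp (split s e f b₁ b₂) R := by
  have h1 : ∀ b, s e b ∈ R := by
    rcases h e with h | h
    · cases b₁ <;> simp_all
    · exact h
  have h2 : ∀ b, s f b ∈ R := by
    rcases h f with h | h
    · cases b₂ <;> simp_all
    · exact h
  intro g
  by_cases hg : g = e
  · right
    intro b
    simp only [split, hg, if_true]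
    split_ifs
    · exact h2 _
    · exact h1 _
  · by_cases hg' : g = f
    · subst hg'; left; simp [split, hg]
    · simpa [split, hg, hg'] using h g

theorem three_sets (s : E → Bool → V) (X Y Z : Set V) (e₁ : E) (b : Bool) (hx : s e₁ b ∈ X)
    (hy : s e₁ b ∈ Y) (hz : s e₁ b ∈ Z) (hx' : s e₁ (!b) ∉ X) (hy' : s e₁ (!b) ∉ Y)
    (hz' : s e₁ (!b) ∉ Z) :
    dg s (X ∩ Y ∩ Z) + dg s (X \ (Y ∪ Z)) + dg s (Y \ (X ∪ Z)) + dg s (Z \ (X ∪ Y)) + 2 ≤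
      dg s X + dg s Y + dg s Z := by
  have : (2:ℕ) = ∑ x : E, if x = e₁ then 2 else 0 := by simp
  rw [this]
  unfold dg
  simp only [← Finset.sum_add_distrib]
  refine Finset.sum_le_sum fun e _ => ?_
  by_cases he : e = e₁
  · subst he
    cases b <;> simp_all
  · simp only [he, if_false]
    by_cases h1 : s e true ∈ X <;> by_cases h2 : s e false ∈ X <;> by_cases h3 : s e true ∈ Y <;>
    by_cases h4 : s e false ∈ Y <;> by_cases h5 : s e true ∈ Z <;> by_cases h6 : s e false ∈ Z <;>
    simp [h1, h2, h3, h4, h5, h6]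

/-- number of edges from `u` into `X` -/
noncomputable def nb (s : E → Bool → V) (u : V) (X : Set V) : ℕ :=
  ∑ e, if (∃ b, s e b ∈ ({u} : Set V) ∧ s e (!b) ∈ X) then 1 else 0

theorem dg_nb (s : E → Bool → V) {u : V} (hu : u ∉ X) :
    dg s {u} + dg s X = dg s ({u} ∪ X) + 2 * nb s u X := by
  apply dg_disj
  rintro x rfl
  exact hu

theorem dg_u (s : E → Bool → V) (u : V) :
    dg s {u} = ∑ e, if (∃ b, s e b = u ∧ s e (!b) ≠ u) then 1 else 0 := by
  unfold dg
  refine Finset.sum_congr rfl fun e _ => ?_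
  by_cases h1 : s e true = u <;> by_cases h2 : s e false = u <;> simp [h1, h2]

theorem split_exists {K : ℕ} (hK : 2 ≤ K) {u v : V} (huR : u ∉ R)
    (hS : Supp s (R ∪ {u, v})) (hdu : Even (dg s {u})) (hdv : Even (dg s {v})) (hC : Conn s R K)
    (hne : ∃ e b, s e b = u ∧ s e (!b) ≠ u) :
    ∃ e f b₁ b₂, e ≠ f ∧ s e b₁ = u ∧ s e (!b₁) ≠ u ∧ s f b₂ = u ∧ s f (!b₂) ≠ u ∧
      Conn (split s e f b₁ b₂) R K := by
  have hother : ∀ e₁ b₁, s e₁ b₁ = u → s e₁ (!b₁) ≠ u → ∃ f b, f ≠ e₁ ∧ s f b = u ∧ s f (!b) ≠ u := by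
    intro e₁ b₁ h1 h2
    by_contra! hc
    have h3 : dg s {u} = 1 := by
      rw [dg_u]
      have : (1:ℕ) = ∑ x : E, if x = e₁ then 1 else 0 := by simp
      rw [this]
      refine Finset.sum_congr rfl fun e _ => ?_
      by_cases he : e = e₁
      · subst he; rw [if_pos ⟨b₁, h1, h2⟩]; simp
      · rw [if_neg]
        · simp [he]
        · rintro ⟨b, h, h'⟩; exact h' (hc e b he h)
    rw [h3] at hdu
    simp at hdu
  by_cases hxR : ∃ e b, s e b = u ∧ s e (!b) ∈ R
  swap
  · -- all edges at `u` go to `v`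
    obtain ⟨e, b₁, he, he'⟩ := hne
    obtain ⟨f, b₂, hfe, hf, hf'⟩ := hother e b₁ he he'
    push Not at hxR
    have hall : ∀ g b, s g b = u → s g (!b) = u ∨ s g (!b) = v := by
      intro g b hg
      rcases hS g with h | h
      · left; cases b <;> simp_all
      · have := h (!b)
        have := hxR g b hg
        simp_all
    have hev : s e (!b₁) = v := (hall e b₁ he).resolve_left he'
    have hfv : s f (!b₂) = v := (hall f b₂ hf).resolve_left hf'
    refine ⟨e, f, b₁, b₂, hfe.symm, he, he', hf, hf', ?_⟩
    have key : ∀ X : Set V, u ∉ X → (∃ x ∈ X, x ∈ R) → (∃ x ∈ R, x ∉ X) →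
        K ≤ dg (split s e f b₁ b₂) X := by
      intro X hu ⟨x, hx, hxR⟩ ⟨y, hy, hyX⟩
      by_cases hvX : v ∈ X
      · refine (hC ({u} ∪ X) ⟨x, Or.inr hx, hxR⟩ ⟨y, hy, ?_⟩).trans ?_
        · rintro (rfl | h)
          · exact huR hy
          · exact hyX h
        · unfold dg
          refine Finset.sum_le_sum fun g _ => ?_
          by_cases hge : g = e
          · have : ∀ b, s g b ∈ ({u} ∪ X : Set V) := by
              intro b; cases b₁ <;> cases b <;> simp_all
            rw [if_pos (iff_of_true (this true) (this false))]; exact Nat.zero_le _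
          · by_cases hgf : g = f
            · have : ∀ b, s g b ∈ ({u} ∪ X : Set V) := by
                intro b; cases b₂ <;> cases b <;> simp_all
              rw [if_pos (iff_of_true (this true) (this false))]; exact Nat.zero_le _
            · have h1 := hall g true
              have h2 := hall g false
              simp only [split, hge, hgf, if_false]
              by_cases h3 : s g true = u
              · rcases h1 h3 with h4 | h4 <;> simp_all
              · by_cases h5 : s g false = u
                · rcases h2 h5 with h4 | h4 <;> simp_all
                · simp [h3, h5]
      · have := dg_split (X := X) hfe.symm he hf hu
        simp only [hev, hfv, hvX, false_and, if_false] at this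
        rw [add_zero] at this
        rw [← this]
        exact hC X ⟨x, hx, hxR⟩ ⟨y, hy, hyX⟩
    intro X ⟨x, hx, hxR⟩ ⟨y, hy, hyX⟩
    by_cases hu : u ∈ X
    · rw [← dg_compl]
      exact key _ (by simpa using hu) ⟨y, hyX, hy⟩ ⟨x, hxR, by simpa using hx⟩
    · exact key X hu ⟨x, hx, hxR⟩ ⟨y, hy, hyX⟩
  · obtain ⟨e₁, b₁, he, hxR⟩ := hxR
    have he' : s e₁ (!b₁) ≠ u := fun h => huR (h ▸ hxR)
    have hbool : ∀ b b' : Bool, b' ≠ b → b' = !b := by decide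
    by_contra! hcon
    let D : Set V → Prop := fun X => u ∉ X ∧ s e₁ (!b₁) ∈ X ∧ (∃ r ∈ R, r ∉ X) ∧ dg s X ≤ K + 1
    have hbad : ∀ f b₂, f ≠ e₁ → s f b₂ = u → s f (!b₂) ≠ u → ∃ X, D X ∧ s f (!b₂) ∈ X := by
      intro f b₂ hfe hf hf'
      have h1 := hcon e₁ f b₁ b₂ hfe.symm he he' hf hf'
      have key : ∀ X : Set V, u ∉ X → (∃ x ∈ X, x ∈ R) → (∃ x ∈ R, x ∉ X) →
        dg (split s e₁ f b₁ b₂) X < K → D X ∧ s f (!b₂) ∈ X := by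
        intro X hu hX hX' hlt
        have h2 := dg_split (X := X) hfe.symm he hf hu
        have h3 := hC X hX hX'
        split_ifs at h2 with h4
        · exact ⟨⟨hu, h4.1, hX', by omega⟩, h4.2⟩
        · omega
      unfold Conn at h1
      push Not at h1
      obtain ⟨X, ⟨y, hy, hyR⟩, ⟨z, hz, hzX⟩, hlt⟩ := h1
      by_cases hu : u ∈ X
      · exact ⟨Xᶜ, key Xᶜ (by simpa using hu) ⟨z, hzX, hz⟩ ⟨y, hyR, by simpa using hy⟩
          (by rwa [dg_compl])⟩
      · exact ⟨X, key X hu ⟨y, hy, hyR⟩ ⟨z, hz, hzX⟩ hlt⟩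
    have hhalf : ∀ X, D X → 2 * nb s u X ≤ dg s {u} := by
      rintro X ⟨hu, hxX, ⟨r, hr, hrX⟩, hX⟩
      have h1 := dg_nb s hu
      have h2 := hC ({u} ∪ X) ⟨_, Or.inr hxX, hxR⟩ ⟨r, hr, by
        rintro (rfl | h)
        · exact huR hr
        · exact hrX h⟩
      obtain ⟨m, hm⟩ := hdu
      omega
    obtain ⟨f₀, b₀, hf₀, hf₀u, hf₀'⟩ := hother e₁ b₁ he he'
    obtain ⟨X₀, hX₀, -⟩ := hbad f₀ b₀ hf₀ hf₀u hf₀'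
    obtain ⟨⟨X, Y⟩, ⟨hX, hY⟩, hmax⟩ := Set.exists_max_image {p : Set V × Set V | D p.1 ∧ D p.2}
      (fun p => nb s u (p.1 ∪ p.2)) (Set.toFinite _) ⟨(X₀, X₀), hX₀, hX₀⟩
    simp only at hX hY hmax
    have hXY : nb s u (X ∪ Y) + 1 ≤ nb s u X + nb s u Y := by
      have : (1:ℕ) = ∑ x : E, if x = e₁ then 1 else 0 := by simp
      rw [this]
      unfold nb
      simp only [← Finset.sum_add_distrib]
      refine Finset.sum_le_sum fun e _ => ?_
      by_cases hee : e = e₁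
      · subst hee
        have g1 : ∃ b, s e b ∈ ({u} : Set V) ∧ s e (!b) ∈ X := ⟨b₁, he, hX.2.1⟩
        have g2 : ∃ b, s e b ∈ ({u} : Set V) ∧ s e (!b) ∈ Y := ⟨b₁, he, hY.2.1⟩
        have g3 : ∃ b, s e b ∈ ({u} : Set V) ∧ s e (!b) ∈ X ∪ Y := ⟨b₁, he, Or.inl hX.2.1⟩
        rw [if_pos g1, if_pos g2, if_pos g3, if_pos rfl]
      · rw [if_neg hee, add_zero]
        by_cases g3 : ∃ b, s e b ∈ ({u} : Set V) ∧ s e (!b) ∈ X ∪ Y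
        · rw [if_pos g3]
          obtain ⟨b, h5, h6⟩ := g3
          rcases h6 with h6 | h6
          · rw [if_pos ⟨b, h5, h6⟩]; omega
          · rw [if_pos (⟨b, h5, h6⟩ : ∃ b, s e b ∈ ({u} : Set V) ∧ s e (!b) ∈ Y)]; omega
        · rw [if_neg g3]; exact Nat.zero_le _
    have hlt : nb s u (X ∪ Y) < dg s {u} := by
      have := hhalf X hX
      have := hhalf Y hY
      omega
    obtain ⟨f, b₂, hf, hf', hfXY⟩ : ∃ f b, s f b = u ∧ s f (!b) ≠ u ∧ s f (!b) ∉ X ∪ Y := by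
      by_contra! hc
      refine absurd hlt (not_lt.2 ?_)
      rw [dg_u]
      refine Finset.sum_le_sum fun e _ => ?_
      split_ifs with h1 h2
      · exact le_rfl
      · obtain ⟨b, h3, h4⟩ := h1
        exact absurd ⟨b, h3, hc e b h3 h4⟩ h2
      · simp
      · simp
    have hfe : f ≠ e₁ := by
      rintro rfl
      have : b₂ = b₁ := by
        by_contra hb
        rw [hbool b₁ b₂ hb] at hf
        exact he' hf
      subst this
      exact hfXY (Or.inl hX.2.1)
    obtain ⟨Z, hZ, hfZ⟩ := hbad f b₂ hfe hf hf'
    have hpriv : ∀ X Y, D X → D Y → nb s u (Y ∪ Z) ≤ nb s u (X ∪ Y) → s f (!b₂) ∉ X ∪ Y →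
        ∃ e b, s e b = u ∧ s e (!b) ∈ X \ (Y ∪ Z) := by
      intro X Y hX hY hle hfXY
      by_contra! hc
      refine absurd hle (not_le.2 (Nat.lt_of_succ_le ?_))
      rw [Nat.succ_eq_add_one]
      have : (1:ℕ) = ∑ x : E, if x = f then 1 else 0 := by simp
      rw [this]
      unfold nb
      simp only [← Finset.sum_add_distrib]
      refine Finset.sum_le_sum fun e _ => ?_
      by_cases hee : e = f
      · subst hee
        rw [if_neg, if_pos (⟨b₂, hf, Or.inr hfZ⟩ :
          ∃ b, s e b ∈ ({u} : Set V) ∧ s e (!b) ∈ Y ∪ Z), if_pos rfl]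
        · rintro ⟨b, h1, h2⟩
          have : b = b₂ := by
            by_contra hb
            rw [← hbool b b₂ (Ne.symm hb), hf] at h2
            exact h2.elim hX.1 hY.1
          subst this
          exact hfXY h2
      · simp only [hee, if_false]
        split_ifs with h1 h2
        · simp
        · exfalso
          obtain ⟨b, h5, h6⟩ := h1
          apply h2
          refine ⟨b, h5, ?_⟩
          by_contra h7
          rcases h6 with h6 | h6
          · exact hc e b h5 ⟨h6, h7⟩
          · exact h7 (Or.inl h6)
        · simp
        · simp
    obtain ⟨e2, c2, h2u, h2⟩ := hpriv X Y hX hY (hmax (Y, Z) ⟨hY, hZ⟩) hfXY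
    obtain ⟨e3, c3, h3u, h3⟩ := hpriv Y X hY hX (by rw [Set.union_comm Y X]; exact hmax (X, Z) ⟨hX, hZ⟩)
      (by rwa [Set.union_comm])
    have h4 : s f (!b₂) ∈ Z \ (X ∪ Y) := ⟨hfZ, hfXY⟩
    have hineq := three_sets s X Y Z e₁ (!b₁) hX.2.1 hY.2.1 hZ.2.1
      (by simpa [he] using hX.1) (by simpa [he] using hY.1) (by simpa [he] using hZ.1)
    have hpc : ∀ P : Set V, u ∉ P → (∃ r ∈ R, r ∉ P) → (∃ e b, s e b = u ∧ s e (!b) ∈ P) →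
        K ≤ dg s P ∨ (v ∈ P ∧ 2 ≤ dg s P) := by
      rintro P hu hr ⟨e, b, h1, h2⟩
      by_cases hPR : ∃ x ∈ P, x ∈ R
      · exact Or.inl (hC P hPR hr)
      · right
        push Not at hPR
        have hne : s e (!b) ≠ u := fun h => hu (h ▸ h2)
        have hv : s e (!b) = v := by
          rcases hS e with h | h
          · exfalso; cases b
            · exact hne (h.trans h1)
            · exact hne (h.symm.trans h1)
          · rcases h (!b) with h | h | h
            · exact absurd h (hPR _ h2)
            · exact absurd h hne
            · exact h
        refine ⟨hv ▸ h2, ?_⟩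
        have h3 : P ∩ (R ∪ {u, v}) = {v} := by
          ext z
          constructor
          · rintro ⟨hz, hz' | hz' | hz'⟩
            · exact absurd hz' (hPR z hz)
            · exact absurd (hz' ▸ hz) hu
            · exact hz'
          · rintro rfl
            exact ⟨hv ▸ h2, by simp⟩
        rw [dg_supp hS, h3]
        have hpos : 0 < dg s {v} := by
          unfold dg
          refine Finset.sum_pos' (fun _ _ => by positivity) ⟨e, Finset.mem_univ _, ?_⟩
          have : u ≠ v := fun h => hne (hv.trans h.symm)
          have h3 : ¬ (s e true ∈ ({v} : Set V) ↔ s e false ∈ ({v} : Set V)) := by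
            rw [Set.mem_singleton_iff, Set.mem_singleton_iff]
            cases b
            · rw [h1, show s e true = v from hv]; simp [this]
            · rw [h1, show s e false = v from hv]; simp [this]
          rw [if_neg h3]
          exact one_pos
        obtain ⟨m, hm⟩ := hdv
        omega
    have k0 := hC (X ∩ Y ∩ Z) ⟨_, ⟨⟨hX.2.1, hY.2.1⟩, hZ.2.1⟩, hxR⟩ (by
      obtain ⟨r, hr, hr'⟩ := hX.2.2.1
      exact ⟨r, hr, fun h => hr' h.1.1⟩)
    have k1 := hpc (X \ (Y ∪ Z)) (fun h => hX.1 h.1) (by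
      obtain ⟨r, hr, hr'⟩ := hX.2.2.1
      exact ⟨r, hr, fun h => hr' h.1⟩) ⟨e2, c2, h2u, h2⟩
    have k2 := hpc (Y \ (X ∪ Z)) (fun h => hY.1 h.1) (by
      obtain ⟨r, hr, hr'⟩ := hY.2.2.1
      exact ⟨r, hr, fun h => hr' h.1⟩) ⟨e3, c3, h3u, h3⟩
    have k3 := hpc (Z \ (X ∪ Y)) (fun h => hZ.1 h.1) (by
      obtain ⟨r, hr, hr'⟩ := hZ.2.2.1
      exact ⟨r, hr, fun h => hr' h.1⟩) ⟨f, b₂, hf, h4⟩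
    have hdX := hX.2.2.2
    have hdY := hY.2.2.2
    have hdZ := hZ.2.2.2
    rcases k1 with k1 | ⟨v1, k1⟩ <;> rcases k2 with k2 | ⟨v2, k2⟩ <;>
      rcases k3 with k3 | ⟨v3, k3⟩ <;> 
      first
      | omega
      | exact absurd v1.1 fun h => v2.2 (Or.inl h)
      | exact absurd v1.1 fun h => v3.2 (Or.inl h)
      | exact absurd v2.1 fun h => v3.2 (Or.inr h)

end splitting

/-! ### Lifting a solution back through the splittings -/

section lifting
variable {V E : Type*} [Fintype V] [Fintype E] {R : Set V}

theorem lift_split {odd : Prop} {t : V} {k : ℕ} {s s'' : E → Bool → V} {e f : E} {b₁ b₂ : Bool} {u : V}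
    (hef : e ≠ f) (he : s e b₁ = u) (hf : s f b₂ = u) (heq : Eqv (split s e f b₁ b₂) s'')
    {C : Set (E × Bool)} (hsol : Sol odd t k s'' C R) :
    ∃ s3 C3, Eqv s s3 ∧ Sol odd t k s3 C3 R ∧ ∀ v, Bal s'' v → Bal s3 v := by
  have hfe := hef.symm
  have hfl : ∀ b, s'' f b = u := by
    intro b
    rcases heq f with h | h <;> rw [h b] <;> simp [split, hfe, hf]
  obtain ⟨c, hc1, hc2⟩ : ∃ c, s'' e c = s e (!b₁) ∧ s'' e (!c) = s f (!b₂) := by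
    rcases heq e with h | h
    · exact ⟨!b₁, by rw [h]; simp [split], by rw [h]; simp [split]⟩
    · exact ⟨b₁, by rw [h]; simp [split], by rw [h]; simp [split]⟩
  let s3 : E → Bool → V := fun g b =>
    if g = e then (if b = c then s e (!b₁) else u)
    else if g = f then (if b = c then u else s f (!b₂)) else s'' g b
  have s3e : ∀ b, s3 e b = if b = c then s e (!b₁) else u := fun b => by simp [s3]
  have s3f : ∀ b, s3 f b = if b = c then u else s f (!b₂) := fun b => by simp [s3, hfe]
  have s3g : ∀ g b, g ≠ e → g ≠ f → s3 g b = s'' g b := fun g b h1 h2 => by simp [s3, h1, h2]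
  let C3 : Set (E × Bool) := {p | if p.1 = f then (e, p.2) ∈ C else p ∈ C}
  have C3f : ∀ b, (f, b) ∈ C3 ↔ (e, b) ∈ C := fun b => by simp [C3]
  have C3g : ∀ g b, g ≠ f → ((g, b) ∈ C3 ↔ (g, b) ∈ C) := fun g b h => by simp [C3, h]
  refine ⟨s3, C3, ?_, ⟨?_, ?_⟩, ?_⟩
  · intro g
    by_cases hg : g = e
    · subst hg
      by_cases hcb : c = b₁
      · right; intro b; rw [s3e]
        subst hcb
        cases b <;> cases c <;> simp_all
      · left; intro b; rw [s3e]
        have : c = !b₁ := by cases c <;> cases b₁ <;> simp_all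
        subst this
        cases b <;> cases b₁ <;> simp_all
    · by_cases hg' : g = f
      · subst hg'
        by_cases hcb : c = b₂
        · left; intro b; rw [s3f]
          subst hcb
          cases b <;> cases c <;> simp_all
        · right; intro b; rw [s3f]
          have : c = !b₂ := by cases c <;> cases b₂ <;> simp_all
          subst this
          cases b <;> cases b₂ <;> simp_all
      · have := heq g
        simp only [split, hg, hg', if_false] at this
        simpa only [s3g g _ hg hg'] using this
  · intro X hX hXR b
    refine (hsol.cut X hX hXR b).trans ?_
    unfold oC
    refine sum_le_two hef ?_ ?_
    · intro g h1 h2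
      simp only [lv, s3g g _ h1 h2, C3g g _ h2]
      exact le_of_eq (by congr)
    · simp only [lv, s3e, s3f, C3f, C3g e _ hef, hfl]
      by_cases hb : b = c
      · subst hb
        simp only [hc1, hc2]
        by_cases h1 : s e (!b₁) ∈ X <;> by_cases h2 : s f (!b₂) ∈ X <;> by_cases h3 : u ∈ X <;>
          by_cases h4 : (e, b) ∈ C <;> simp [h1, h2, h3, h4]
      · have : c = !b := by cases c <;> cases b <;> simp_all
        subst this
        rw [Bool.not_not] at hc2
        simp only [hc1, hc2]
        by_cases h1 : s e (!b₁) ∈ X <;> by_cases h2 : s f (!b₂) ∈ X <;> by_cases h3 : u ∈ X <;>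
          by_cases h4 : (e, b) ∈ C <;> simp [h1, h2, h3, h4]
  · intro ho X hX hXR
    obtain ⟨g, b, hgC, hg⟩ := hsol.conn ho X hX hXR
    by_cases hgf : g = f
    · subst hgf
      exact absurd (by rw [hfl]; have := hg.1; rwa [hfl] at this) hg.2
    by_cases hge : g = e
    · subst hge
      by_cases h3 : lv s3 X g b
      · exact ⟨g, b, (C3g g b hgf).2 hgC, h3⟩
      · refine ⟨f, b, (C3f b).2 hgC, ?_⟩
        unfold lv at h3 hg ⊢
        simp only [s3e, s3f] at h3 ⊢
        by_cases hb : b = c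
        · subst hb
          simp_all
        · have : c = !b := by cases c <;> cases b <;> simp_all
          subst this
          simp_all
    · exact ⟨g, b, (C3g g b hgf).2 hgC, by simpa only [lv, s3g g _ hge hgf] using hg⟩
  · intro v hv
    have key : ∀ b, (∑ g, if s'' g b = v then 1 else 0) = ∑ g, if s3 g b = v then 1 else 0 := by
      intro b
      refine sum_eq_two hef ?_ ?_
      · intro g h1 h2; rw [s3g g _ h1 h2]
      · rw [hfl, s3e, s3f]
        by_cases hb : b = c
        · subst hb; simp [hc1]
        · have : c = !b := by cases c <;> cases b <;> simp_all
          subst this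
          rw [Bool.not_not] at hc2
          simp [hc2, add_comm]
    unfold Bal at hv ⊢
    rw [← key, ← key, hv]

theorem even_split {s : E → Bool → V} {e f : E} {b₁ b₂ : Bool} {u w : V}
    (hef : e ≠ f) (he : s e b₁ = u) (hf : s f b₂ = u) (h : Even (dg s {w})) :
    Even (dg (split s e f b₁ b₂) {w}) := by
  have key : ∀ X : Set V, u ∉ X → Even (dg s X) → Even (dg (split s e f b₁ b₂) X) := by
    intro X hX h
    rw [dg_split hef he hf hX] at h
    split_ifs at h
    · rcases h with ⟨m, hm⟩
      exact ⟨m - 1, by omega⟩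
    · exact h
  by_cases hw : u ∈ ({w} : Set V)
  · rw [← dg_compl]
    refine key _ (by simpa using hw) ?_
    rwa [dg_compl]
  · exact key _ hw h

theorem split_all {odd : Prop} {t : V} {k K : ℕ} (hK : 2 ≤ K) {u v : V} (hu : u ∉ R) (hv : v ∉ R)
    (n : ℕ) : ∀ s : E → Bool → V, nl s ≤ n → Supp s (R ∪ {u, v}) → Even (dg s {u}) →
    Even (dg s {v}) → Conn s R K →
    (∀ s' : E → Bool → V, nl s' ≤ n → Supp s' R → Conn s' R K →
      ∃ s'' C, Eqv s' s'' ∧ Sol odd t k s'' C R) →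
    ∃ s'' C, Eqv s s'' ∧ Sol odd t k s'' C R ∧ ∀ w ∉ R, Bal s'' w := by
  induction n with
  | zero =>
    intro s hn hS hdu hdv hC IH
    have hl : ∀ e, s e true = s e false := by
      intro e
      unfold nl at hn
      have := (Finset.sum_eq_zero_iff.1 (Nat.le_zero.1 hn)) e (Finset.mem_univ e)
      by_contra h
      simp [h] at this
    have hS' : Supp s R := fun e => Or.inl (hl e)
    obtain ⟨s'', C, h1, h2⟩ := IH s hn hS' hC
    exact ⟨s'', C, h1, h2, fun w hw => Bal_of_supp (h1.supp hS') hw⟩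
  | succ n ih =>
    intro s hn hS hdu hdv hC IH
    have key : ∀ u v, u ∉ R → Supp s (R ∪ {u, v}) → Even (dg s {u}) → Even (dg s {v}) →
        (∀ s' : E → Bool → V, Supp s' (R ∪ {u, v}) → nl s' ≤ n → Even (dg s' {u}) →
          Even (dg s' {v}) → Conn s' R K → ∃ s'' C, Eqv s' s'' ∧ Sol odd t k s'' C R ∧
            ∀ w ∉ R, Bal s'' w) →
        (∃ e b, s e b = u ∧ s e (!b) ≠ u) →
        ∃ s'' C, Eqv s s'' ∧ Sol odd t k s'' C R ∧ ∀ w ∉ R, Bal s'' w := by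
      intro u v hu hS hdu hdv IH' hne
      obtain ⟨e, f, b₁, b₂, hef, he, he', hf, hf', hC'⟩ := split_exists hK hu hS hdu hdv hC hne
      have hlt := nl_split hef he he' hf hf'
      obtain ⟨s'', C, h1, h2, h3⟩ := IH' _ (supp_split he he' hf hf' hS) (by omega)
        (even_split hef he hf hdu) (even_split hef he hf hdv) hC'
      obtain ⟨s3, C3, h4, h5, h6⟩ := lift_split hef he hf h1 h2
      exact ⟨s3, C3, h4, h5, fun w hw => h6 w (h3 w hw)⟩
    have IH2 : ∀ s' : E → Bool → V, nl s' ≤ n → Supp s' R → Conn s' R K →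
      ∃ s'' C, Eqv s' s'' ∧ Sol odd t k s'' C R := fun s' h => IH s' (by omega)
    by_cases h1 : ∃ e b, s e b = u ∧ s e (!b) ≠ u
    · exact key u v hu hS hdu hdv (fun s' hs' hn' hu' hv' hC' => ih s' hn' hs' hu' hv' hC' IH2) h1
    by_cases h2 : ∃ e b, s e b = v ∧ s e (!b) ≠ v
    · rw [Set.pair_comm] at hS
      exact key v u hv hS hdv hdu (fun s' hs' hn' hu' hv' hC' =>
        ih s' hn' (by rwa [Set.pair_comm] at hs') hv' hu' hC' IH2) h2
    push Not at h1 h2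
    have hS' : Supp s R := by
      intro e
      rcases hS e with h | h
      · exact Or.inl h
      · by_cases hl : s e true = s e false
        · exact Or.inl hl
        · right
          have h3 : ∀ w, (∀ b, s e b = w → s e (!b) = w) → ∀ b, s e b ≠ w := by
            intro w hw b hb
            have := hw b hb
            cases b
            · exact hl (this.trans hb.symm)
            · exact hl (hb.trans this.symm)
          intro b
          rcases h b with h | h | h
          · exact h
          · exact absurd h (h3 u (h1 e) b)
          · exact absurd h (h3 v (h2 e) b)
    obtain ⟨s'', C, h1, h2⟩ := IH s hn hS' hC
    exact ⟨s'', C, h1, h2, fun w hw => Bal_of_supp (h1.supp hS') hw⟩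

end lifting

/-! ### Re-inserting an edge -/

section insertion
variable {V E : Type*} [Fintype V] [Fintype E] {R R' : Set V} {s s₁ : E → Bool → V} {e f : E}
  {C C₁ : Set (E × Bool)} {X : Set V} {t u v : V} {k : ℕ}

theorem loop_not_lv (hl : s e true = s e false) (b : Bool) : ¬ lv s X e b := by
  rintro ⟨h1, h2⟩
  cases b
  · exact h2 (by simpa [hl] using h1)
  · exact h2 (by simpa [hl] using h1)

theorem lv_congr (h : ∀ b, s₁ e b = s e b) (b : Bool) : lv s₁ X e b ↔ lv s X e b := by
  unfold lv; rw [h, h]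

theorem oC_keep (hl : s e true = s e false) (hs : ∀ g, g ≠ e → ∀ b, s₁ g b = s g b) {b : Bool}
    (h : ∀ g, g ≠ e → lv s X g b → (g, b) ∉ C → (g, b) ∉ C₁) : oC s C X b ≤ oC s₁ C₁ X b := by
  unfold oC
  refine Finset.sum_le_sum fun g _ => ?_
  by_cases hg : g = e
  · subst hg
    rw [if_neg fun h => loop_not_lv hl b h.1]
    exact Nat.zero_le _
  · by_cases h1 : lv s X g b ∧ (g, b) ∉ C
    · rw [if_pos h1, if_pos]
      exact ⟨(lv_congr (hs g hg) b).2 h1.1, h g hg h1.1 h1.2⟩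
    · rw [if_neg h1]
      exact Nat.zero_le _

theorem oC_lose (hl : s e true = s e false) (hs : ∀ g, g ≠ e → ∀ b, s₁ g b = s g b) {b : Bool}
    (f : E) (h : ∀ g, g ≠ e → g ≠ f → lv s X g b → (g, b) ∉ C → (g, b) ∉ C₁) :
    oC s C X b ≤ oC s₁ C₁ X b + 1 := by
  unfold oC
  have : (1:ℕ) = ∑ x : E, if x = f then 1 else 0 := by simp
  rw [this, ← Finset.sum_add_distrib]
  refine Finset.sum_le_sum fun g _ => ?_
  by_cases hg : g = e
  · subst hg
    rw [if_neg fun h => loop_not_lv hl b h.1]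
    exact Nat.zero_le _
  · by_cases h1 : lv s X g b ∧ (g, b) ∉ C
    · rw [if_pos h1]
      by_cases hgf : g = f
      · rw [if_pos hgf]; omega
      rw [if_pos]
      · omega
      exact ⟨(lv_congr (hs g hg) b).2 h1.1, h g hg hgf h1.1 h1.2⟩
    · rw [if_neg h1]
      exact Nat.zero_le _

theorem oC_swap (hl : s e true = s e false) (hs : ∀ g, g ≠ e → ∀ b, s₁ g b = s g b) {b : Bool}
    {f : E} (hef : e ≠ f) (he : lv s₁ X e b) (heC : (e, b) ∉ C₁)
    (h : ∀ g, g ≠ e → g ≠ f → lv s X g b → (g, b) ∉ C → (g, b) ∉ C₁) :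
    oC s C X b ≤ oC s₁ C₁ X b := by
  unfold oC
  refine sum_le_two hef ?_ ?_
  · intro g hg hgf
    by_cases h1 : lv s X g b ∧ (g, b) ∉ C
    · rw [if_pos h1, if_pos]
      exact ⟨(lv_congr (hs g hg) b).2 h1.1, h g hg hgf h1.1 h1.2⟩
    · rw [if_neg h1]
      exact Nat.zero_le _
  · have h1 : (if lv s₁ X e b ∧ (e, b) ∉ C₁ then 1 else 0) = 1 := if_pos ⟨he, heC⟩
    have h2 : (if lv s X e b ∧ (e, b) ∉ C then 1 else 0) = 0 :=
      if_neg fun h => loop_not_lv hl b h.1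
    have h3 : (if lv s X f b ∧ (f, b) ∉ C then 1 else 0) ≤ 1 := by
      by_cases h : lv s X f b ∧ (f, b) ∉ C
      · rw [if_pos h]
      · rw [if_neg h]; omega
    rw [h1, h2]
    omega

def Wit (s : E → Bool → V) (C : Set (E × Bool)) (t : V) (R' : Set V) : Prop :=
  ∀ g b, (g, b) ∈ C → ∃ X : Set V, t ∉ X ∧ (∃ x ∈ X, x ∈ R') ∧ lv s X g b ∧
    ∀ g' b', (g', b') ∈ C → lv s X g' b' → g' = g ∧ b' = b

theorem prune (h : Sol True t k s C R') : ∃ C', Sol True t k s C' R' ∧ Wit s C' t R' := by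
  let F : Set (Set (E × Bool)) := {D | D ⊆ C ∧ ∀ X : Set V, t ∉ X → (∃ x ∈ X, x ∈ R') →
    ∃ e b, (e, b) ∈ D ∧ lv s X e b}
  obtain ⟨D, ⟨hDC, hD⟩, hmin⟩ := Set.exists_min_image F Set.ncard (Set.toFinite _)
    ⟨C, subset_rfl, h.conn trivial⟩
  refine ⟨D, ⟨fun X ht hX b => (h.cut X ht hX b).trans (oC_anti (fun e b _ hh => hDC hh) b),
    fun _ => hD⟩, ?_⟩
  intro g b hg
  by_contra! hcon
  have hlt : (D \ {(g, b)}).ncard < D.ncard := Set.ncard_sdiff_singleton_lt_of_mem hg (Set.toFinite _)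
  refine absurd (hmin (D \ {(g, b)}) ⟨fun x hx => hDC hx.1, ?_⟩) (not_le.2 hlt)
  intro X ht hX
  by_contra! hc
  obtain ⟨g₁, b₁, h1, h2⟩ := hD X ht hX
  have hall : ∀ g' b', (g', b') ∈ D → lv s X g' b' → g' = g ∧ b' = b := by
    intro g' b' h3 h4
    by_contra h5
    exact hc g' b' ⟨h3, fun h6 => h5 (Prod.mk.inj h6)⟩ h4
  obtain ⟨rfl, rfl⟩ := hall g₁ b₁ h1 h2
  obtain ⟨g', b', h3, h4, h5⟩ := hcon X ht hX h2
  exact h5 (hall g' b' h3 h4).1 (hall g' b' h3 h4).2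

theorem Wit.uniq (hW : Wit s C t R') (h : Sol True t k s C R') {g₁ g₂ : E} {b₁ b₂ : Bool}
    (h1 : (g₁, b₁) ∈ C) (h2 : (g₂, b₂) ∈ C) (heq : s g₁ b₁ = s g₂ b₂) : g₁ = g₂ ∧ b₁ = b₂ := by
  obtain ⟨X, hX, ⟨x, hx, hx'⟩, hlX, hXu⟩ := hW g₁ b₁ h1
  obtain ⟨Y, hY, -, hlY, hYu⟩ := hW g₂ b₂ h2
  obtain ⟨g, b, hg, hl, hl'⟩ := h.conn trivial (X ∪ Y) (fun h => h.elim hX hY) ⟨x, Or.inl hx, hx'⟩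
  have hl1 : s g (!b) ∉ X := fun h => hl' (Or.inl h)
  have hl2 : s g (!b) ∉ Y := fun h => hl' (Or.inr h)
  rcases hl with hl | hl
  · obtain ⟨rfl, rfl⟩ := hXu g b hg ⟨hl, hl1⟩
    exact hYu g b hg ⟨heq ▸ hlY.1, hl2⟩
  · obtain ⟨rfl, rfl⟩ := hYu g b hg ⟨hl, hl2⟩
    have := hXu g b hg ⟨heq ▸ hlX.1, hl1⟩
    exact ⟨this.1.symm, this.2.symm⟩

theorem Wit.ne (hW : Wit s C t R') {g : E} {b : Bool} (h : (g, b) ∈ C) : s g b ≠ s g (!b) := by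
  obtain ⟨X, hX, -, hl, -⟩ := hW g b h
  exact fun h => hl.2 (h ▸ hl.1)

theorem Wit.notloop (hW : Wit s C t R') (hl : s e true = s e false) (b : Bool) : (e, b) ∉ C := by
  intro h
  have := hW.ne h
  cases b <;> simp_all

/-- the result of re-inserting the edge `e` between `u` and `v` -/
def Res (s : E → Bool → V) (e : E) (t u v : V) (k : ℕ) (R : Set V) : Prop :=
  ∃ s₁ C₁, (∀ g, g ≠ e → ∀ b, s₁ g b = s g b) ∧ (∃ c, s₁ e c = u ∧ s₁ e (!c) = v) ∧
    Sol True t k s₁ C₁ R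

theorem Res.symm (h : Res s e t u v k R) : Res s e t v u k R := by
  obtain ⟨s₁, C₁, h1, ⟨c, h2, h3⟩, h4⟩ := h
  exact ⟨s₁, C₁, h1, ⟨!c, h3, by simpa using h2⟩, h4⟩

/-- place `e` from `u` to `v` in direction `c` -/
noncomputable def place (s : E → Bool → V) (e : E) (u v : V) (c : Bool) : E → Bool → V := fun g b =>
  if g = e then (if b = c then u else v) else s g b

theorem place_ne (g : E) (hg : g ≠ e) (c b : Bool) : place s e u v c g b = s g b := by
  simp [place, hg]

theorem place_src (c : Bool) : place s e u v c e c = u := by simp [place]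

theorem place_dst (c : Bool) : place s e u v c e (!c) = v := by simp [place]

theorem bool_cases (b c : Bool) : b = c ∨ b = !c := by cases b <;> cases c <;> simp

theorem supp_place (hS : Supp s R) (hu : u ∈ R) (hv : v ∈ R) (c : Bool) :
    Supp (place s e u v c) R := by
  intro g
  by_cases hg : g = e
  · right; intro b; subst hg; simp only [place, if_true]; split_ifs <;> assumption
  · simpa only [place_ne g hg] using hS g

theorem caseS (hS : Supp s R) (hl : s e true = s e false) (huR : u ∈ R) (hvR : v ∈ R)
    (huv : u ≠ v) (hR' : R' = R \ {u}) (hsol : Sol True t k s C R') (hW : Wit s C t R')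
    (hu : ∀ b, k ≤ oC s ∅ {u} b) : Res s e t u v k R := by
  have hcase : ∀ X : Set V, (∃ x ∈ X, x ∈ R) → (∃ x ∈ X, x ∈ R') ∨ X ∩ R = {u} := by
    rintro X ⟨x, hx, hxR⟩
    by_cases h : ∃ x ∈ X, x ∈ R'
    · exact Or.inl h
    · right
      push Not at h
      have h1 : ∀ y ∈ X, y ∈ R → y = u := by
        intro y hy hyR
        by_contra hyu
        exact h y hy (by rw [hR']; exact ⟨hyR, hyu⟩)
      ext y
      constructor
      · rintro ⟨hy, hyR⟩; exact h1 y hy hyR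
      · rintro rfl; exact ⟨h1 x hx hxR ▸ hx, huR⟩
  have heC := hW.notloop hl
  have hne : ∀ {g b}, (g, b) ∈ C → g ≠ e := fun h hg => heC _ (hg ▸ h)
  by_cases hout : ∃ f c, (f, c) ∈ C ∧ s f c = u
  · obtain ⟨f, c, hfC, hf⟩ := hout
    have hfe : f ≠ e := hne hfC
    have hs := fun g hg b => place_ne (s := s) (e := e) (u := u) (v := v) g hg c b
    have hS1 : Supp (place s e u v c) R := supp_place hS huR hvR c
    refine ⟨place s e u v c, C, hs, ⟨c, place_src c, place_dst c⟩, ?_, ?_⟩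
    · intro X ht hX b
      rcases hcase X hX with h | h
      · exact (hsol.cut X ht h b).trans (oC_keep hl hs fun g _ _ h => h)
      · rw [oC_supp hS1, h]
        refine (hu b).trans ?_
        rcases bool_cases b c with rfl | rfl
        · refine oC_swap hl hs hfe.symm ⟨place_src b, ?_⟩ (heC b) ?_
          · rw [place_dst]; exact huv.symm
          · intro g hg hgf hlg _ hgC
            exact hgf (hW.uniq hsol hgC hfC (hlg.1.trans hf.symm)).1
        · refine oC_keep hl hs ?_
          intro g hg hlg _ hgC
          have := (hW.uniq hsol hgC hfC (hlg.1.trans hf.symm)).2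
          simp at this
    · intro _ X ht hX
      rcases hcase X hX with h | h
      · obtain ⟨g, b, hg, hlg⟩ := hsol.conn trivial X ht h
        exact ⟨g, b, hg, (lv_congr (hs g (hne hg)) b).2 hlg⟩
      · refine ⟨f, c, hfC, (lv_congr (hs f hfe) c).2 ?_⟩
        rw [lv_supp hS, h]
        exact ⟨hf, fun h => hW.ne hfC (hf.trans h.symm)⟩
  · push Not at hout
    have hs := fun g hg b => place_ne (s := s) (e := e) (u := u) (v := v) g hg true b
    have hS1 : Supp (place s e u v true) R := supp_place hS huR hvR true
    have hC1 : ∀ g b, g ≠ e → (g, b) ∉ C → (g, b) ∉ insert (e, true) C := by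
      rintro g b hg h (h1 | h1)
      · exact hg (Prod.mk.inj h1).1
      · exact h h1
    refine ⟨place s e u v true, insert (e, true) C, hs, ⟨true, place_src _, place_dst _⟩, ?_, ?_⟩
    · intro X ht hX b
      rcases hcase X hX with h | h
      · exact (hsol.cut X ht h b).trans (oC_keep hl hs fun g hg _ h => hC1 g b hg h)
      · rw [oC_supp hS1, h]
        refine (hu b).trans (oC_keep hl hs ?_)
        intro g hg hlg _
        exact hC1 g b hg fun hgC => hout g b hgC hlg.1
    · intro _ X ht hX
      rcases hcase X hX with h | h
      · obtain ⟨g, b, hg, hlg⟩ := hsol.conn trivial X ht h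
        exact ⟨g, b, Or.inr hg, (lv_congr (hs g (hne hg)) b).2 hlg⟩
      · refine ⟨e, true, Or.inl rfl, ?_⟩
        rw [lv_supp hS1, h]
        exact ⟨place_src _, by rw [place_dst]; exact huv.symm⟩

theorem pair_cases (huR : u ∈ R) (hvR : v ∈ R) (hR' : R' = R \ {u, v}) (X : Set V)
    (hX : ∃ x ∈ X, x ∈ R) : (∃ x ∈ X, x ∈ R') ∨ (X ∩ R = {u} ∧ v ∉ X) ∨ (X ∩ R = {v} ∧ u ∉ X) ∨
      (X ∩ R = {u, v} ∧ u ∈ X ∧ v ∈ X) := by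
  obtain ⟨x, hx, hxR⟩ := hX
  by_cases h : ∃ x ∈ X, x ∈ R'
  · exact Or.inl h
  · right
    push Not at h
    have h1 : ∀ y ∈ X, y ∈ R → y = u ∨ y = v := by
      intro y hy hyR
      by_contra hyu
      exact h y hy (by rw [hR']; exact ⟨hyR, hyu⟩)
    by_cases hu : u ∈ X
    · by_cases hv : v ∈ X
      · right; right
        refine ⟨?_, hu, hv⟩
        ext y
        constructor
        · rintro ⟨hy, hyR⟩; exact h1 y hy hyR
        · rintro (rfl | rfl)
          · exact ⟨hu, huR⟩
          · exact ⟨hv, hvR⟩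
      · left
        refine ⟨?_, hv⟩
        ext y
        constructor
        · rintro ⟨hy, hyR⟩
          exact (h1 y hy hyR).resolve_right (fun h => hv (h ▸ hy))
        · rintro rfl; exact ⟨hu, huR⟩
    · right; left
      refine ⟨?_, hu⟩
      ext y
      constructor
      · rintro ⟨hy, hyR⟩
        exact (h1 y hy hyR).resolve_left (fun h => hu (h ▸ hy))
      · rintro rfl
        refine ⟨?_, hvR⟩
        rcases h1 x hx hxR with rfl | rfl
        · exact absurd hx hu
        · exact hx

theorem caseD1 (hS : Supp s R) (hl : s e true = s e false) (huR : u ∈ R) (hvR : v ∈ R)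
    (huv : u ≠ v) (hR' : R' = R \ {u, v}) (hsol : Sol True t k s C R') (hW : Wit s C t R')
    (hu : ∀ b, k ≤ oC s ∅ {u} b) (hv : ∀ b, k ≤ oC s ∅ {v} b)
    (hd : ∀ b, k + 1 ≤ oC s ∅ {u, v} b) {f : E} {c : Bool} (hfC : (f, c) ∈ C) (hf : s f c = u)
    (hP : ∀ X : Set V, t ∉ X → u ∈ X → v ∈ X → ∃ g b, (g, b) ∈ C ∧ lv s X g b ∧ s g b ≠ v) :
    Res s e t u v k R := by
  have heC := hW.notloop hl
  have hne : ∀ {g b}, (g, b) ∈ C → g ≠ e := fun h hg => heC _ (hg ▸ h)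
  have hfe : f ≠ e := hne hfC
  have hs := fun g hg b => place_ne (s := s) (e := e) (u := u) (v := v) g hg c b
  have hS1 : Supp (place s e u v c) R := supp_place hS huR hvR c
  let C₁ : Set (E × Bool) := insert (e, !c) {p | p ∈ C ∧ s p.1 p.2 ≠ v}
  have hC1 : ∀ g b, g ≠ e → (g, b) ∈ C₁ → (g, b) ∈ C ∧ s g b ≠ v := by
    rintro g b hg (h1 | h1)
    · exact absurd (Prod.mk.inj h1).1 hg
    · exact h1
  have hecC : (e, c) ∉ C₁ := by
    rintro (h1 | h1)
    · have := (Prod.mk.inj h1).2; simp at this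
    · exact heC _ h1.1
  have hsrc : place s e u v c e (!c) = v := place_dst c
  refine ⟨place s e u v c, C₁, hs, ⟨c, place_src c, place_dst c⟩, ?_, ?_⟩
  · intro X ht hX b
    rcases pair_cases huR hvR hR' X hX with h | ⟨h, hvX⟩ | ⟨h, huX⟩ | ⟨h, huX, hvX⟩
    · exact (hsol.cut X ht h b).trans (oC_keep hl hs fun g hg _ h h' => h (hC1 g b hg h').1)
    · rw [oC_supp hS1, h]
      refine (hu b).trans ?_
      rcases bool_cases b c with rfl | rfl
      · refine oC_swap hl hs hfe.symm ⟨place_src b, ?_⟩ hecC ?_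
        · rw [place_dst]; exact huv.symm
        · intro g hg hgf hlg _ hgC
          exact hgf (hW.uniq hsol (hC1 g b hg hgC).1 hfC (hlg.1.trans hf.symm)).1
      · refine oC_keep hl hs ?_
        intro g hg hlg _ hgC
        have := (hW.uniq hsol (hC1 _ _ hg hgC).1 hfC (hlg.1.trans hf.symm)).2
        simp at this
    · rw [oC_supp hS1, h]
      refine (hv b).trans (oC_keep hl hs ?_)
      intro g hg hlg _ hgC
      exact (hC1 _ _ hg hgC).2 hlg.1
    · rw [oC_supp hS1, h]
      have h1 := hd b
      have h2 : oC s ∅ {u, v} b ≤ oC (place s e u v c) C₁ {u, v} b + 1 := by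
        refine oC_lose hl hs f ?_
        intro g hg hgf hlg _ hgC
        have h3 := hC1 _ _ hg hgC
        have h4 : s g b = u := hlg.1.resolve_right h3.2
        exact hgf (hW.uniq hsol h3.1 hfC (h4.trans hf.symm)).1
      omega
  · intro _ X ht hX
    have hgood : ∀ g b, (g, b) ∈ C → lv s X g b → s g b ≠ v →
        ∃ e_1 b, (e_1, b) ∈ C₁ ∧ lv (place s e u v c) X e_1 b := by
      intro g b hgC hlg hgv
      exact ⟨g, b, Or.inr ⟨hgC, hgv⟩, (lv_congr (hs g (hne hgC)) b).2 hlg⟩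
    by_cases hvX : v ∈ X
    · by_cases huX : u ∈ X
      · obtain ⟨g, b, h1, h2, h3⟩ := hP X ht huX hvX
        exact hgood g b h1 h2 h3
      · refine ⟨e, !c, Or.inl rfl, ?_⟩
        unfold lv
        rw [Bool.not_not, place_src, place_dst]
        exact ⟨hvX, huX⟩
    · rcases pair_cases huR hvR hR' X hX with h | ⟨h, -⟩ | ⟨h, huX⟩ | ⟨h, huX, hvX'⟩
      · obtain ⟨g, b, hg, hlg⟩ := hsol.conn trivial X ht h
        exact hgood g b hg hlg fun h => hvX (h ▸ hlg.1)
      · refine hgood f c hfC ?_ (by rw [hf]; exact huv)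
        rw [lv_supp hS, h]
        exact ⟨hf, fun h => hW.ne hfC (hf.trans h.symm)⟩
      · have : v ∈ X ∩ R := by rw [h]; rfl
        exact absurd this.1 hvX
      · exact absurd hvX' hvX

theorem caseD2 (hS : Supp s R) (hl : s e true = s e false) (huR : u ∈ R) (hvR : v ∈ R)
    (huv : u ≠ v) (hR' : R' = R \ {u, v}) (hsol : Sol True t k s C R') (hW : Wit s C t R')
    (hu : ∀ b, k ≤ oC s ∅ {u} b) (hv : ∀ b, k ≤ oC s ∅ {v} b)
    (hd : ∀ b, k + 1 ≤ oC s ∅ {u, v} b) (hno : ∀ g b, (g, b) ∈ C → s g b ≠ u ∧ s g b ≠ v)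
    {f : E} (hf : s f true = u) (hf' : s f false ≠ u) (hf'' : s f false ≠ v)
    (hP : ∀ X : Set V, t ∉ X → u ∈ X → v ∈ X → (∃ x ∈ X, x ∈ R') → lv s X f true →
      k + 1 ≤ oC s C X true) :
    Res s e t u v k R := by
  have heC := hW.notloop hl
  have hne : ∀ {g b}, (g, b) ∈ C → g ≠ e := fun h hg => heC _ (hg ▸ h)
  have hfe : f ≠ e := by
    rintro rfl
    exact hf' (hl.symm.trans hf)
  have hs := fun g hg b => place_ne (s := s) (e := e) (u := u) (v := v) g hg true b
  have hS1 : Supp (place s e u v true) R := supp_place hS huR hvR true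
  let C₁ : Set (E × Bool) := insert (e, false) (insert (f, true) C)
  have hC1 : ∀ g b, g ≠ e → (g, b) ∈ C₁ → (g, b) ∉ C → g = f ∧ b = true := by
    rintro g b hg (h1 | h1 | h1) h2
    · exact absurd (Prod.mk.inj h1).1 hg
    · exact Prod.mk.inj h1
    · exact absurd h1 h2
  have hecC : (e, true) ∉ C₁ := by
    rintro (h1 | h1 | h1)
    · have := (Prod.mk.inj h1).2; simp at this
    · exact hfe (Prod.mk.inj h1).1.symm
    · exact heC _ h1
  have hpt : place s e u v true e true = u := place_src true
  have hpf : place s e u v true e false = v := place_dst true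
  refine ⟨place s e u v true, C₁, hs, ⟨true, hpt, hpf⟩, ?_, ?_⟩
  · intro X ht hX b
    rcases pair_cases huR hvR hR' X hX with h | ⟨h, hvX⟩ | ⟨h, huX⟩ | ⟨h, huX, hvX⟩
    · have hk := hsol.cut X ht h b
      by_cases hlf : lv s X f true ∧ b = true
      · obtain ⟨hlf, rfl⟩ := hlf
        have huX : u ∈ X := hf ▸ hlf.1
        by_cases hvX : v ∈ X
        · have h1 := hP X ht huX hvX h hlf
          have h2 : oC s C X true ≤ oC (place s e u v true) C₁ X true + 1 :=
            oC_lose hl hs f fun g hg hgf _ h1 h2 => hgf (hC1 g _ hg h2 h1).1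
          omega
        · refine hk.trans (oC_swap hl hs hfe.symm ⟨?_, ?_⟩ hecC ?_)
          · rwa [hpt]
          · rw [Bool.not_true, hpf]; exact hvX
          · exact fun g hg hgf _ h1 h2 => hgf (hC1 g _ hg h2 h1).1
      · refine hk.trans (oC_keep hl hs ?_)
        intro g hg hlg h1 h2
        obtain ⟨rfl, rfl⟩ := hC1 g _ hg h2 h1
        exact hlf ⟨hlg, rfl⟩
    · rw [oC_supp hS1, h]
      refine (hu b).trans ?_
      cases b
      · refine oC_keep hl hs ?_
        intro g hg hlg _ hgC
        by_cases hgC' : (g, false) ∈ C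
        · exact (hno _ _ hgC').1 hlg.1
        · have := (hC1 g _ hg hgC hgC').2
          simp at this
      · refine oC_swap hl hs hfe.symm ⟨hpt, ?_⟩ hecC ?_
        · rw [Bool.not_true, hpf]; exact huv.symm
        · intro g hg hgf hlg _ hgC
          by_cases hgC' : (g, true) ∈ C
          · exact (hno _ _ hgC').1 hlg.1
          · exact hgf (hC1 g _ hg hgC hgC').1
    · rw [oC_supp hS1, h]
      refine (hv b).trans (oC_keep hl hs ?_)
      intro g hg hlg _ hgC
      by_cases hgC' : (g, b) ∈ C
      · exact (hno _ _ hgC').2 hlg.1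
      · obtain ⟨rfl, rfl⟩ := hC1 g _ hg hgC hgC'
        exact huv (hf.symm.trans hlg.1)
    · rw [oC_supp hS1, h]
      have h1 := hd b
      have h2 : oC s ∅ {u, v} b ≤ oC (place s e u v true) C₁ {u, v} b + 1 := by
        refine oC_lose hl hs f ?_
        intro g hg hgf hlg _ hgC
        by_cases hgC' : (g, b) ∈ C
        · exact hlg.1.elim (hno _ _ hgC').1 (hno _ _ hgC').2
        · exact hgf (hC1 g _ hg hgC hgC').1
      omega
  · intro _ X ht hX
    have hfl : lv s {u, v} f true := ⟨Or.inl hf, fun h => h.elim hf' hf''⟩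
    rcases pair_cases huR hvR hR' X hX with h | ⟨h, hvX⟩ | ⟨h, huX⟩ | ⟨h, huX, hvX⟩
    · obtain ⟨g, b, hg, hlg⟩ := hsol.conn trivial X ht h
      exact ⟨g, b, Or.inr (Or.inr hg), (lv_congr (hs g (hne hg)) b).2 hlg⟩
    · refine ⟨f, true, Or.inr (Or.inl rfl), (lv_congr (hs f hfe) _).2 ?_⟩
      rw [lv_supp hS, h]
      exact ⟨hf, hf'⟩
    · refine ⟨e, false, Or.inl rfl, ?_⟩
      rw [lv_supp hS1, h]
      unfold lv
      rw [hpf, Bool.not_false, hpt]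
      exact ⟨rfl, huv⟩
    · refine ⟨f, true, Or.inr (Or.inl rfl), (lv_congr (hs f hfe) _).2 ?_⟩
      rw [lv_supp hS, h]
      exact hfl

theorem redirect (hW : Wit s C t R') (hsol : Sol True t k s C R') (huv : u ≠ v) {f : E} {c : Bool}
    (hfC : (f, c) ∈ C) (hf : s f c = u) :
    (∀ X : Set V, t ∉ X → u ∈ X → v ∈ X → ∃ g b, (g, b) ∈ C ∧ lv s X g b ∧ s g b ≠ v) ∨
    ((∃ f c, (f, c) ∈ C ∧ s f c = v) ∧
    (∀ X : Set V, t ∉ X → v ∈ X → u ∈ X → ∃ g b, (g, b) ∈ C ∧ lv s X g b ∧ s g b ≠ u)) := by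
  by_contra! hcon
  obtain ⟨⟨X, ht, huX, hvX, hX⟩, h2⟩ := hcon
  obtain ⟨Z, htZ, ⟨z, hz, hzR⟩, hlZ, hZ⟩ := hW f c hfC
  by_cases hv : ∃ f c, (f, c) ∈ C ∧ s f c = v
  · obtain ⟨Y, htY, hvY, huY, hY⟩ := h2 hv
    obtain ⟨g, b, hg, hl, hl'⟩ := hsol.conn trivial (X ∪ Y ∪ Z)
      (fun h => h.elim (fun h => h.elim ht htY) htZ) ⟨z, Or.inr hz, hzR⟩
    have h1 : s g (!b) ∉ X := fun h => hl' (Or.inl (Or.inl h))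
    have h2 : s g (!b) ∉ Y := fun h => hl' (Or.inl (Or.inr h))
    have h3 : s g (!b) ∉ Z := fun h => hl' (Or.inr h)
    have hXb : s g b ∉ X := by
      intro h
      have h4 := hX g b hg ⟨h, h1⟩
      have h5 := hY g b hg ⟨h4 ▸ hvY, h2⟩
      exact huv (h5.symm.trans h4)
    have hYb : s g b ∉ Y := by
      intro h
      have h5 := hY g b hg ⟨h, h2⟩
      exact hXb (h5 ▸ huX)
    rcases hl with (hl | hl) | hl
    · exact hXb hl
    · exact hYb hl
    · obtain ⟨rfl, rfl⟩ := hZ g b hg ⟨hl, h3⟩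
      exact hXb (hf ▸ huX)
  · push Not at hv
    obtain ⟨g, b, hg, hl, hl'⟩ := hsol.conn trivial (X ∪ Z)
      (fun h => h.elim ht htZ) ⟨z, Or.inr hz, hzR⟩
    have h1 : s g (!b) ∉ X := fun h => hl' (Or.inl h)
    have h3 : s g (!b) ∉ Z := fun h => hl' (Or.inr h)
    have hXb : s g b ∉ X := fun h => hv g b hg (hX g b hg ⟨h, h1⟩)
    rcases hl with hl | hl
    · exact hXb hl
    · obtain ⟨rfl, rfl⟩ := hZ g b hg ⟨hl, h3⟩
      exact hXb (hf ▸ huX)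

/-- the arc to be added to `C` when neither `u` nor `v` has one -/
theorem find_arc (hS : Supp s R) (huR : u ∈ R) (hvR : v ∈ R) (hR' : R' = R \ {u, v})
    (hsol : Sol True t k s C R') (hd : ∀ b, k + 1 ≤ oC s ∅ {u, v} b)
    (hno : ∀ g b, (g, b) ∈ C → s g b ≠ u ∧ s g b ≠ v) :
    ∃ f, lv s {u, v} f true ∧ ∀ X : Set V, t ∉ X → u ∈ X → v ∈ X → (∃ x ∈ X, x ∈ R') →
      lv s X f true → k + 1 ≤ oC s C X true := by
  have hd' : k + 1 ≤ oC s C {u, v} true := (hd true).trans (oC_lose_none (by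
    intro g hg hgC
    exact hg.1.elim (hno _ _ hgC).1 (hno _ _ hgC).2))
  have hge : ∀ X : Set V, t ∉ X → u ∈ X → v ∈ X → k ≤ oC s C X true := by
    intro X ht hu hv
    rcases pair_cases huR hvR hR' X ⟨u, hu, huR⟩ with h | ⟨h, hvX⟩ | ⟨h, huX⟩ | ⟨h, huX, hvX⟩
    · exact hsol.cut X ht h true
    · exact absurd hv hvX
    · exact absurd hu huX
    · rw [oC_supp hS, h]; omega
  let T : Set (Set V) := {X | t ∉ X ∧ u ∈ X ∧ v ∈ X ∧ oC s C X true ≤ k}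
  by_cases hT : T.Nonempty
  · obtain ⟨X₀, ⟨h1, h2, h3, h4⟩, hmin⟩ := Set.exists_min_image T Set.ncard (Set.toFinite _) hT
    have hsub : ∀ X ∈ T, X₀ ⊆ X := by
      rintro X ⟨h5, h6, h7, h8⟩
      have h9 := oC_submod s C true X₀ X
      have h10 := hge (X₀ ∪ X) (fun h => h.elim h1 h5) (Or.inl h2) (Or.inl h3)
      have h11 := hmin (X₀ ∩ X) ⟨fun h => h1 h.1, ⟨h2, h6⟩, ⟨h3, h7⟩, by omega⟩
      have := Set.eq_of_subset_of_ncard_le (Set.inter_subset_left (s := X₀) (t := X)) h11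
        (Set.toFinite _)
      exact Set.inter_eq_left.1 this
    obtain ⟨f, hf, hf'⟩ : ∃ f, lv s {u, v} f true ∧ s f false ∈ X₀ := by
      by_contra! hc
      have : oC s C {u, v} true ≤ oC s C X₀ true := by
        unfold oC
        refine Finset.sum_le_sum fun g _ => ?_
        by_cases hg : lv s {u, v} g true ∧ (g, true) ∉ C
        · rw [if_pos hg, if_pos]
          refine ⟨⟨?_, hc g hg.1⟩, hg.2⟩
          rcases hg.1.1 with h | h
          · rw [h]; exact h2
          · rw [show s g true = v from h]; exact h3
        · rw [if_neg hg]; exact Nat.zero_le _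
      omega
    refine ⟨f, hf, ?_⟩
    intro X ht hu hv _ hlX
    by_contra hlt
    exact hlX.2 (hsub X ⟨ht, hu, hv, by omega⟩ hf')
  · obtain ⟨f, hf⟩ : ∃ f, lv s {u, v} f true := by
      by_contra! hc
      have : oC s C {u, v} true = 0 := by
        unfold oC
        refine Finset.sum_eq_zero fun g _ => ?_
        rw [if_neg fun h => hc g h.1]
      omega
    refine ⟨f, hf, ?_⟩
    intro X ht hu hv _ _
    by_contra hlt
    exact hT ⟨X, ht, hu, hv, by omega⟩

theorem caseD (hS : Supp s R) (hl : s e true = s e false) (huR : u ∈ R) (hvR : v ∈ R)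
    (huv : u ≠ v) (hR' : R' = R \ {u, v}) (hsol : Sol True t k s C R') (hW : Wit s C t R')
    (hu : ∀ b, k ≤ oC s ∅ {u} b) (hv : ∀ b, k ≤ oC s ∅ {v} b)
    (hd : ∀ b, k + 1 ≤ oC s ∅ {u, v} b) : Res s e t u v k R := by
  have hR'' : R' = R \ {v, u} := by rw [hR', Set.pair_comm]
  have hd' : ∀ b, k + 1 ≤ oC s ∅ {v, u} b := by rwa [Set.pair_comm]
  by_cases h1 : ∃ f c, (f, c) ∈ C ∧ s f c = u
  · obtain ⟨f, c, hfC, hf⟩ := h1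
    rcases redirect hW hsol huv hfC hf with h | ⟨⟨g, d, hgC, hg⟩, h⟩
    · exact caseD1 hS hl huR hvR huv hR' hsol hW hu hv hd hfC hf h
    · exact (caseD1 hS hl hvR huR huv.symm hR'' hsol hW hv hu hd' hgC hg h).symm
  by_cases h2 : ∃ f c, (f, c) ∈ C ∧ s f c = v
  · obtain ⟨f, c, hfC, hf⟩ := h2
    rcases redirect hW hsol huv.symm hfC hf with h | ⟨⟨g, d, hgC, hg⟩, h⟩
    · exact (caseD1 hS hl hvR huR huv.symm hR'' hsol hW hv hu hd' hfC hf h).symm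
    · exact caseD1 hS hl huR hvR huv hR' hsol hW hu hv hd hgC hg h
  push Not at h1 h2
  have hno : ∀ g b, (g, b) ∈ C → s g b ≠ u ∧ s g b ≠ v := fun g b h => ⟨h1 g b h, h2 g b h⟩
  obtain ⟨f, hf, hP⟩ := find_arc hS huR hvR hR' hsol hd hno
  have h3 : s f false ≠ u := fun h => hf.2 (Or.inl h)
  have h4 : s f false ≠ v := fun h => hf.2 (Or.inr h)
  rcases hf.1 with h | h
  · exact caseD2 hS hl huR hvR huv hR' hsol hW hu hv hd hno h h3 h4 hP
  · exact (caseD2 hS hl hvR huR huv.symm hR'' hsol hW hv hu hd' (fun g b h => (hno g b h).symm)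
      h h4 h3 fun X ht hv hu => hP X ht hu hv).symm

end insertion

/-! ### The main induction -/

section main
variable {V E : Type*} [Fintype V] [Fintype E] {R : Set V} {s : E → Bool → V} {e : E}
  {X Y : Set V} {t : V} {k K : ℕ}

def Claim (odd : Prop) (t : V) (k : ℕ) (s : E → Bool → V) (R : Set V) : Prop :=
  ∃ s'' C, Eqv s s'' ∧ Sol odd t k s'' C R

noncomputable def del (s : E → Bool → V) (e : E) : E → Bool → V := fun g b =>
  if g = e then s e true else s g b

theorem del_self (b : Bool) : del s e e b = s e true := by simp [del]

theorem del_ne {g : E} (hg : g ≠ e) (b : Bool) : del s e g b = s g b := by simp [del, hg]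

theorem dg_del (s : E → Bool → V) (e : E) (X : Set V) :
    dg s X = dg (del s e) X + (if (s e true ∈ X ↔ s e false ∈ X) then 0 else 1) := by
  have := sum_add_one (F := fun g => if (s g true ∈ X ↔ s g false ∈ X) then 0 else 1)
    (G := fun g => if (del s e g true ∈ X ↔ del s e g false ∈ X) then 0 else 1) e
    (fun g hg => by simp only [del_ne hg])
  simp only [del_self, if_true, add_zero] at this
  exact this

theorem nl_del (he : s e true ≠ s e false) : nl (del s e) < nl s := by
  have := sum_add_one (F := fun g => if s g true = s g false then 0 else 1)
    (G := fun g => if del s e g true = del s e g false then 0 else 1) e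
    (fun g hg => by simp only [del_ne hg])
  simp only [del_self, if_true, add_zero, if_neg he] at this
  unfold nl
  omega

theorem supp_del (hS : Supp s R) : Supp (del s e) R := by
  intro g
  by_cases hg : g = e
  · subst hg; left; rw [del_self, del_self]
  · simpa only [del_ne hg] using hS g

theorem eqv_place {s'' s₁ : E → Bool → V} (h : Eqv (del s e) s'')
    (hs : ∀ g, g ≠ e → ∀ b, s₁ g b = s'' g b) (he : ∃ c d, s₁ e c = s e d ∧ s₁ e (!c) = s e (!d)) :
    Eqv s s₁ := by
  intro g
  by_cases hg : g = e
  · subst hg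
    obtain ⟨c, d, h1, h2⟩ := he
    rcases bool_cases c d with rfl | rfl
    · left; intro b
      rcases bool_cases b c with rfl | rfl
      · exact h1
      · exact h2
    · right; intro b
      rw [Bool.not_not] at h2
      rcases bool_cases b d with rfl | rfl
      · exact h2
      · rw [Bool.not_not]; exact h1
  · have := h g
    simpa only [del_ne hg, ← hs g hg] using this

theorem claim_del {odd : Prop} (h : Claim odd t k (del s e) R) : Claim odd t k s R := by
  obtain ⟨s'', C, h1, h2⟩ := h
  have hl : s'' e true = s'' e false := by
    rcases h1 e with h | h <;> rw [h, h, del_self, del_self]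
  let s₁ : E → Bool → V := fun g b => if g = e then s e b else s'' g b
  have hs : ∀ g, g ≠ e → ∀ b, s₁ g b = s'' g b := fun g hg b => by simp [s₁, hg]
  have hse : ∀ b, s₁ e b = s e b := fun b => by simp [s₁]
  refine ⟨s₁, C, eqv_place h1 hs ⟨true, true, hse _, hse _⟩, ⟨?_, ?_⟩⟩
  · intro X ht hX b
    exact (h2.cut X ht hX b).trans (oC_keep hl hs fun g _ _ h => h)
  · intro ho X ht hX
    obtain ⟨g, b, h3, h4⟩ := h2.conn ho X ht hX
    refine ⟨g, b, h3, (lv_congr (hs g ?_) b).2 h4⟩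
    rintro rfl
    exact loop_not_lv hl b h4

def Ti (s : E → Bool → V) (R : Set V) (t : V) (K : ℕ) (X : Set V) : Prop :=
  t ∉ X ∧ X ⊆ R ∧ X.Nonempty ∧ dg s X = K

theorem cross_tight (hS : Supp s R) (hC : Conn s R K) (hX : ∃ x ∈ X, x ∈ R)
    (hX' : ∃ x ∈ R, x ∉ X) (h : dg (del s e) X < K) :
    ∃ Y, (Y = X ∩ R ∨ Y = Xᶜ ∩ R) ∧ Ti s R t K Y ∧ ∃ b, lv s Y e b := by
  have h1 := dg_del s e X
  have h2 := hC X hX hX'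
  have hcr : ¬ (s e true ∈ X ↔ s e false ∈ X) := by
    intro hh; rw [if_pos hh] at h1; omega
  rw [if_neg hcr] at h1
  have key : ∀ X : Set V, (∃ x ∈ X, x ∈ R) → t ∉ X → dg s X = K →
      ¬ (s e true ∈ X ↔ s e false ∈ X) → Ti s R t K (X ∩ R) ∧ ∃ b, lv s (X ∩ R) e b := by
    intro X ⟨x, hx, hxR⟩ ht hd hcr
    refine ⟨⟨fun h => ht h.1, Set.inter_subset_right, ⟨x, hx, hxR⟩, ?_⟩, ?_⟩
    · rw [← dg_supp hS, hd]
    · by_cases h1 : s e true ∈ X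
      · refine ⟨true, (lv_supp hS e _).1 ⟨h1, fun h2 => hcr (iff_of_true h1 h2)⟩⟩
      · refine ⟨false, (lv_supp hS e _).1 ⟨?_, h1⟩⟩
        by_contra h2
        exact hcr (iff_of_false h1 h2)
  by_cases ht : t ∈ X
  · refine ⟨Xᶜ ∩ R, Or.inr rfl, key Xᶜ ?_ (by simpa using ht) (by rw [dg_compl]; omega) ?_⟩
    · obtain ⟨x, hx, hx'⟩ := hX'
      exact ⟨x, hx', hx⟩
    · simp only [Set.mem_compl_iff]
      rwa [not_iff_not]
  · exact ⟨X ∩ R, Or.inl rfl, key X hX ht (by omega) hcr⟩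

theorem tight_of_not (hS : Supp s R) (hC : Conn s R K) (h : ¬ Conn (del s e) R K) :
    ∃ Y, Ti s R t K Y ∧ ∃ b, lv s Y e b := by
  unfold Conn at h
  push Not at h
  obtain ⟨X, hX, hX', h⟩ := h
  obtain ⟨Y, -, hY⟩ := cross_tight (t := t) hS hC hX hX' h
  exact ⟨Y, hY⟩

theorem edge_inside (ht : t ∈ R) (hK : 1 ≤ K) (hC : Conn s R K) (hX : Ti s R t K X)
    (hne : ¬ X.Subsingleton) : ∃ e b, s e b ∈ X ∧ s e (!b) ∈ X ∧ s e b ≠ s e (!b) := by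
  obtain ⟨x, hx, y, hy, hxy⟩ := Set.not_subsingleton_iff.1 hne
  obtain ⟨htX, hXR, -, hd⟩ := hX
  have hdj := dg_disj s {x} (X \ {x}) (by rintro z rfl h; exact h.2 rfl)
  have h1 := hC {x} ⟨x, rfl, hXR hx⟩ ⟨t, ht, fun h => htX (by rw [show t = x from h]; exact hx)⟩
  have h2 := hC (X \ {x}) ⟨y, ⟨hy, Ne.symm hxy⟩, hXR hy⟩ ⟨t, ht, fun h => htX h.1⟩
  have h3 : {x} ∪ X \ {x} = X := by
    rw [Set.union_sdiff_cancel]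
    simpa using hx
  rw [h3, hd] at hdj
  by_contra! hc
  have hno : ∀ e, ¬ ∃ b, s e b ∈ ({x} : Set V) ∧ s e (!b) ∈ X \ {x} := by
    rintro e ⟨b, hb1, hb2⟩
    have hb1 : s e b = x := hb1
    exact hb2.2 ((hc e b (by rwa [hb1]) hb2.1).symm.trans hb1)
  simp only [hno, if_false, Finset.sum_const_zero] at hdj
  omega

theorem edge_at (ht : t ∈ R) (hK : 1 ≤ K) (hC : Conn s R K) (hR : R ≠ {t}) :
    ∃ e, s e true ≠ s e false := by
  obtain ⟨r, hr, hrt⟩ : ∃ r ∈ R, r ≠ t := by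
    by_contra! h
    exact hR (Set.eq_singleton_iff_unique_mem.2 ⟨ht, h⟩)
  have h1 := hC {r} ⟨r, rfl, hr⟩ ⟨t, ht, fun h => hrt (Eq.symm h)⟩
  have h4 : dg s {r} ≠ 0 := by omega
  unfold dg at h4
  obtain ⟨e, -, he⟩ := Finset.exists_ne_zero_of_sum_ne_zero h4
  refine ⟨e, fun h => he ?_⟩
  rw [if_pos (by rw [h])]

theorem claim_trivial (odd : Prop) : Claim odd t k s {t} := by
  refine ⟨s, ∅, Eqv.refl s, ⟨?_, ?_⟩⟩
  · rintro X ht ⟨x, hx, rfl⟩; exact absurd hx ht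
  · rintro - X ht ⟨x, hx, rfl⟩; exact absurd hx ht

theorem main_even (t : V) (k : ℕ) (hk : 1 ≤ k) (n : ℕ) : ∀ (s : E → Bool → V) (R : Set V),
    nl s + R.ncard ≤ n → t ∈ R → Supp s R → Conn s R (2 * k) → Claim False t k s R := by
  induction n with
  | zero =>
    intro s R hn ht _ _
    have := (Set.ncard_pos (Set.toFinite R)).2 ⟨t, ht⟩
    omega
  | succ n ih =>
    intro s R hn ht hS hC
    by_cases hrem : ∃ e, s e true ≠ s e false ∧ Conn (del s e) R (2 * k)
    · obtain ⟨e, he, hCe⟩ := hrem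
      have := nl_del he
      exact claim_del (ih _ R (by omega) ht (supp_del hS) hCe)
    by_cases hR : R = {t}
    · rw [hR]; exact claim_trivial _
    push Not at hrem
    obtain ⟨e₀, he₀⟩ := edge_at ht (by omega) hC hR
    obtain ⟨Y₀, hY₀, -⟩ := tight_of_not (t := t) hS hC (hrem e₀ he₀)
    obtain ⟨X, hX, hmin⟩ := Set.exists_min_image {X | Ti s R t (2 * k) X} Set.ncard
      (Set.toFinite _) ⟨Y₀, hY₀⟩
    have hsub : X.Subsingleton := by
      by_contra hns
      obtain ⟨e, b, h1, h2, h3⟩ := edge_inside ht (by omega) hC hX hns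
      have he : s e true ≠ s e false := by
        cases b
        · exact h3.symm
        · exact h3
      obtain ⟨Y, hY, b', hlY⟩ := tight_of_not (t := t) hS hC (hrem e he)
      have hall : ∀ b, s e b ∈ X := by
        intro c
        rcases bool_cases c b with rfl | rfl <;> assumption
      have hsm := dg_submod s X Y
      have hi := hC (X ∩ Y) ⟨_, ⟨hall b', hlY.1⟩, hX.2.1 (hall b')⟩ ⟨t, ht, fun h => hX.1 h.1⟩
      have hun := hC (X ∪ Y) ⟨_, Or.inl (hall b'), hX.2.1 (hall b')⟩
        ⟨t, ht, fun h => h.elim hX.1 hY.1⟩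
      have hdX := hX.2.2.2
      have hdY := hY.2.2.2
      have := hmin (X ∩ Y) ⟨fun h => hX.1 h.1, fun x hx => hX.2.1 hx.1, ⟨_, hall b', hlY.1⟩,
        by omega⟩
      have := Set.eq_of_subset_of_ncard_le (Set.inter_subset_left (s := X) (t := Y)) this
        (Set.toFinite _)
      have h4 : s e (!b') ∈ X ∩ Y := by rw [this]; exact hall _
      exact hlY.2 h4.2
    obtain ⟨htX, hXR, ⟨z, hz⟩, hd⟩ := hX
    have hXz : X = {z} := hsub.eq_singleton_of_mem hz
    rw [hXz] at hd
    have hzR : z ∈ R := hXR hz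
    have hzt : t ≠ z := fun h => htX (h ▸ hz)
    have hRz : R \ {z} ∪ {z, z} = R := by
      rw [Set.pair_eq_singleton]
      exact Set.sdiff_union_of_subset (by simpa using hzR)
    have hcard : (R \ {z}).ncard < R.ncard := Set.ncard_sdiff_singleton_lt_of_mem hzR (Set.toFinite _)
    have hev : Even (dg s {z}) := by rw [hd]; exact even_two_mul k
    obtain ⟨s'', C, heq, hsol, hbal⟩ := split_all (odd := False) (t := t) (k := k) (K := 2 * k)
      (R := R \ {z}) (u := z) (v := z) (by omega) (by simp) (by simp) (nl s) s le_rfl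
      (by rwa [hRz]) hev hev (hC.mono Set.sdiff_subset)
      (fun s' hn' hS' hC' => ih s' _ (by omega) ⟨ht, hzt⟩ hS' hC')
    refine ⟨s'', ∅, heq, ⟨?_, False.elim⟩⟩
    intro X htX hX b
    by_cases h : ∃ x ∈ X, x ∈ R \ {z}
    · exact (hsol.cut X htX h b).trans (oC_zero_le b)
    · push Not at h
      have h1 : ∀ y ∈ X, y ∈ R → y = z := by
        intro y hy hyR
        by_contra hyu
        exact h y hy ⟨hyR, hyu⟩
      have h2 : X ∩ R = {z} := by
        obtain ⟨x, hx, hxR⟩ := hX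
        ext y
        constructor
        · rintro ⟨hy, hyR⟩; exact h1 y hy hyR
        · rintro rfl; exact ⟨h1 x hx hxR ▸ hx, hzR⟩
      rw [oC_supp (heq.supp hS), h2]
      have h3 := (hbal z (by simp)).single
      have h4 := dg_eq s'' {z}
      rw [← heq.dg, hd] at h4
      cases b <;> omega

theorem cross_free (ht : t ∈ R) (hC : Conn s R (2 * k + 1)) (hX : Ti s R t (2 * k + 1) X)
    (hY : Ti s R t (2 * k + 1) Y) (hi : (X ∩ Y).Nonempty) : X ⊆ Y ∨ Y ⊆ X := by
  by_contra! hcon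
  obtain ⟨h1, h2⟩ := hcon
  obtain ⟨x, hx, hxY⟩ := Set.not_subset.1 h1
  obtain ⟨y, hy, hyX⟩ := Set.not_subset.1 h2
  obtain ⟨z, hz, hzY⟩ := hi
  have a1 := dg_submod s X Y
  have a2 := dg_diff s X Y
  have b1 := hC (X ∩ Y) ⟨z, ⟨hz, hzY⟩, hX.2.1 hz⟩ ⟨t, ht, fun h => hX.1 h.1⟩
  have b2 := hC (X ∪ Y) ⟨z, Or.inl hz, hX.2.1 hz⟩ ⟨t, ht, fun h => h.elim hX.1 hY.1⟩
  have b3 := hC (X \ Y) ⟨x, ⟨hx, hxY⟩, hX.2.1 hx⟩ ⟨t, ht, fun h => hX.1 h.1⟩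
  have b4 := hC (Y \ X) ⟨y, ⟨hy, hyX⟩, hY.2.1 hy⟩ ⟨t, ht, fun h => hY.1 h.1⟩
  have c := dg_disj s (X \ Y) (X ∩ Y) (fun x h1 h2 => h1.2 h2.2)
  rw [Set.sdiff_union_inter] at c
  have d1 := hX.2.2.2
  have d2 := hY.2.2.2
  omega

theorem odd_edge (ht : t ∈ R) (hC : Conn s R (2 * k + 1)) (hR : R ≠ {t}) :
    ∃ e, s e true ≠ s e false ∧ ∀ X, Ti s R t (2 * k + 1) X → ∀ b, lv s X e b → X = {s e b} := by
  by_cases h : ∃ X, Ti s R t (2 * k + 1) X ∧ ¬ X.Subsingleton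
  · obtain ⟨X, ⟨hX, hXs⟩, hmin⟩ := Set.exists_min_image
      {X | Ti s R t (2 * k + 1) X ∧ ¬ X.Subsingleton} Set.ncard (Set.toFinite _) h
    obtain ⟨e, b, h1, h2, h3⟩ := edge_inside ht (by omega) hC hX hXs
    have he : s e true ≠ s e false := by
      cases b
      · exact h3.symm
      · exact h3
    have hall : ∀ b, s e b ∈ X := by
      intro c
      rcases bool_cases c b with rfl | rfl <;> assumption
    refine ⟨e, he, ?_⟩
    intro Y hY c hlY
    have hYX : Y ⊆ X := by
      rcases cross_free ht hC hX hY ⟨_, hall c, hlY.1⟩ with h | h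
      · exact absurd (h (hall _)) hlY.2
      · exact h
    by_cases hYs : Y.Subsingleton
    · exact hYs.eq_singleton_of_mem hlY.1
    · have := Set.eq_of_subset_of_ncard_le hYX (hmin Y ⟨hY, hYs⟩) (Set.toFinite _)
      exact absurd (this ▸ hall _) hlY.2
  · push Not at h
    obtain ⟨e, he⟩ := edge_at ht (by omega) hC hR
    exact ⟨e, he, fun X hX b hl => (h X hX).eq_singleton_of_mem hl.1⟩

theorem main_odd (t : V) (k : ℕ) (hk : 1 ≤ k) (n : ℕ) : ∀ (s : E → Bool → V) (R : Set V),
    nl s + R.ncard ≤ n → t ∈ R → Supp s R → Conn s R (2 * k + 1) → Claim True t k s R := by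
  induction n with
  | zero =>
    intro s R hn ht _ _
    have := (Set.ncard_pos (Set.toFinite R)).2 ⟨t, ht⟩
    omega
  | succ n ih =>
    intro s R hn ht hS hC
    by_cases hrem : ∃ e, s e true ≠ s e false ∧ Conn (del s e) R (2 * k + 1)
    · obtain ⟨e, he, hCe⟩ := hrem
      have := nl_del he
      exact claim_del (ih _ R (by omega) ht (supp_del hS) hCe)
    by_cases hR : R = {t}
    · rw [hR]; exact claim_trivial _
    push Not at hrem
    obtain ⟨e, he, hesing⟩ := odd_edge ht hC hR
    have hnl := nl_del he
    obtain ⟨Y, hY, b, hlY⟩ := tight_of_not (t := t) hS hC (hrem e he)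
    obtain rfl := hesing Y hY b hlY
    have heR : ∀ c, s e c ∈ R := (hS e).resolve_left he
    have hne : s e b ≠ s e (!b) := by
      cases b
      · exact he.symm
      · exact he
    have hdel : ∀ c, Ti s R t (2 * k + 1) {s e c} → dg (del s e) {s e c} = 2 * k := by
      intro c hc
      have h1 := dg_del s e {s e c}
      have h2 := hc.2.2.2
      rw [if_neg] at h1
      · omega
      · cases c
        · simpa using he
        · simpa using he.symm
    have hconn : ∀ R', R' ⊆ R → (∀ c, Ti s R t (2 * k + 1) {s e c} → s e c ∉ R') →
        Conn (del s e) R' (2 * k + 1) := by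
      intro R' hR' hcR X ⟨x, hx, hxR⟩ ⟨y, hyR, hy⟩
      by_contra hlt
      obtain ⟨Y, hYX, hY, c, hlY⟩ := cross_tight (t := t) hS hC ⟨x, hx, hR' hxR⟩ ⟨y, hR' hyR, hy⟩
        (not_le.1 hlt)
      obtain rfl := hesing Y hY c hlY
      have h1 := hcR c hY
      rcases hYX with h | h
      · have h2 : x ∈ ({s e c} : Set V) := by rw [h]; exact ⟨hx, hR' hxR⟩
        rw [Set.mem_singleton_iff] at h2
        exact h1 (h2 ▸ hxR)
      · have h2 : y ∈ ({s e c} : Set V) := by rw [h]; exact ⟨hy, hR' hyR⟩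
        rw [Set.mem_singleton_iff] at h2
        exact h1 (h2 ▸ hyR)
    have htu : t ≠ s e b := fun h => hY.1 h
    have hbalk : ∀ s'' : E → Bool → V, Eqv (del s e) s'' → ∀ c, Ti s R t (2 * k + 1) {s e c} →
        Bal s'' (s e c) → ∀ b, k ≤ oC s'' ∅ {s e c} b := by
      intro s'' heq c hc hb b
      have h1 := hb.single
      have h2 := dg_eq s'' {s e c}
      rw [← heq.dg, hdel c hc] at h2
      cases b <;> omega
    have hloop : ∀ s'' : E → Bool → V, Eqv (del s e) s'' → s'' e true = s'' e false := by
      intro s'' h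
      rcases h e with h | h <;> rw [h, h, del_self, del_self]
    have hfin : ∀ s'' : E → Bool → V, Eqv (del s e) s'' →
        Res s'' e t (s e b) (s e (!b)) k R → Claim True t k s R := by
      rintro s'' heq ⟨s₁, C₁, h1, ⟨c, h2, h3⟩, h4⟩
      exact ⟨s₁, C₁, eqv_place heq h1 ⟨c, b, h2, h3⟩, h4⟩
    have hcard : ∀ Q : Set V, (R \ ({s e b} ∪ Q)).ncard < R.ncard := by
      intro Q
      refine Set.ncard_lt_ncard ⟨Set.sdiff_subset, fun h => ?_⟩ (Set.toFinite _)
      exact (h (heR b)).2 (Or.inl rfl)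
    by_cases hv : Ti s R t (2 * k + 1) {s e (!b)}
    · -- both ends are removed
      have hcard' := hcard {s e (!b)}
      rw [Set.singleton_union] at hcard'
      have htv : t ≠ s e (!b) := fun h => hv.1 h
      have hRR : R \ {s e b, s e (!b)} ∪ {s e b, s e (!b)} = R := by
        refine Set.sdiff_union_of_subset ?_
        rintro x (rfl | rfl) <;> exact heR _
      obtain ⟨s'', C, heq, hsol, hbal⟩ := split_all (odd := True) (t := t) (k := k) (K := 2 * k + 1)
        (R := R \ {s e b, s e (!b)}) (u := s e b) (v := s e (!b)) (by omega) (by simp) (by simp)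
        (nl (del s e)) (del s e) le_rfl
        (by rw [hRR]; exact supp_del hS) (by rw [hdel b hY]; exact even_two_mul k)
        (by rw [hdel _ hv]; exact even_two_mul k)
        (hconn _ Set.sdiff_subset (by
          intro c _ h
          rcases bool_cases c b with rfl | rfl
          · exact h.2 (Or.inl rfl)
          · exact h.2 (Or.inr rfl)))
        (fun s' hn' hS' hC' => ih s' _ (by omega) ⟨ht, fun h => h.elim htu htv⟩ hS' hC')
      obtain ⟨C', hsol', hW⟩ := prune hsol
      have hbu := hbal (s e b) (by simp)
      have hbv := hbal (s e (!b)) (by simp)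
      refine hfin s'' heq (caseD (heq.supp (supp_del hS)) (hloop s'' heq) (heR _) (heR _) hne rfl
        hsol' hW (hbalk s'' heq b hY hbu) (hbalk s'' heq _ hv hbv) ?_)
      intro c
      have h1 := hbu.pair hbv hne
      have h2 := dg_eq s'' {s e b, s e (!b)}
      have h3 := dg_del s e {s e b, s e (!b)}
      have h4 : ∀ c, s e c ∈ ({s e b, s e (!b)} : Set V) := by
        intro c
        rcases bool_cases c b with rfl | rfl
        · exact Or.inl rfl
        · exact Or.inr rfl
      rw [if_pos (iff_of_true (h4 true) (h4 false))] at h3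
      have h5 := hC {s e b, s e (!b)} ⟨_, h4 b, heR b⟩ ⟨t, ht, fun h => h.elim htu htv⟩
      rw [← heq.dg] at h2
      cases c <;> omega
    · have hcard' := hcard ∅
      rw [Set.union_empty] at hcard'
      have hRR : R \ {s e b} ∪ {s e b, s e b} = R := by
        rw [Set.pair_eq_singleton]
        exact Set.sdiff_union_of_subset (by simpa using heR b)
      have hev : Even (dg (del s e) {s e b}) := by rw [hdel b hY]; exact even_two_mul k
      obtain ⟨s'', C, heq, hsol, hbal⟩ := split_all (odd := True) (t := t) (k := k) (K := 2 * k + 1)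
        (R := R \ {s e b}) (u := s e b) (v := s e b) (by omega) (by simp) (by simp)
        (nl (del s e)) (del s e) le_rfl
        (by rw [hRR]; exact supp_del hS) hev hev
        (hconn _ Set.sdiff_subset (by
          intro c hc h
          rcases bool_cases c b with rfl | rfl
          · exact h.2 rfl
          · exact hv hc))
        (fun s' hn' hS' hC' => ih s' _ (by omega) ⟨ht, htu⟩ hS' hC')
      obtain ⟨C', hsol', hW⟩ := prune hsol
      exact hfin s'' heq (caseS (heq.supp (supp_del hS)) (hloop s'' heq) (heR _) (heR _) hne rfl
        hsol' hW (hbalk s'' heq b hY (hbal (s e b) (by simp))))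

end main

/-! ### From orientations to arborescences -/

section pack
variable {V E : Type*} [Fintype V] [Fintype E] {s : E → Bool → V} {t : V} {k : ℕ}
  {C : Set (E × Bool)}

/-- A packing: parent maps and arc sets. -/
def Packing (odd : Prop) (t : V) (k : ℕ) (s : E → Bool → V) (par : ℕ → V → V)
    (P : ℕ → Set (E × Bool)) : Prop :=
  (∀ i, (i < 2 * k ∨ (odd ∧ i = 2 * k)) →
    (∀ v, v ≠ t → ∃ e b, (e, b) ∈ P i ∧ s e b = v ∧ s e (!b) = par i v) ∧
    (∀ v, ∃ n, (par i)^[n] v = t)) ∧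
  (∀ i j, i ≤ 2 * k → j ≤ 2 * k → i ≠ j → ∀ p ∈ P i, p ∉ P j) ∧
  (∀ i, i < k → ∀ p ∈ P i, p.2 = true) ∧
  (∀ i, k ≤ i → i < 2 * k → ∀ p ∈ P i, p.2 = false)

theorem packing_of_sol {odd : Prop} (h : Sol odd t k s C Set.univ) :
    ∃ par P, Packing odd t k s par P := by
  have hb : ∀ b : Bool, ∃ (par : Fin k → V → V) (T : Fin k → Set E), (∀ i, T i ⊆ {e | (e, b) ∉ C}) ∧
      (∀ i v, v ≠ t → ∃ a ∈ T i, s a b = v ∧ s a (!b) = par i v) ∧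
      (∀ i v, ∃ n, (par i)^[n] v = t) ∧ (∀ i j, i ≠ j → ∀ a ∈ T i, a ∉ T j) := by
    intro b
    refine edmonds (fun e => s e b) (fun e => s e (!b)) t k {e | (e, b) ∉ C} ?_
    intro X ht ⟨x, hx⟩
    refine (h.cut X ht ⟨x, hx, trivial⟩ b).trans (le_of_eq ?_)
    unfold oC outN lv
    refine Finset.sum_congr rfl fun e _ => ?_
    simp only [Set.mem_setOf_eq, and_assoc]
  choose parb T hTC hTs hTr hTd using hb
  have hc : ∃ (par : V → V) (D : Set (E × Bool)), D ⊆ C ∧ (odd →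
      (∀ v, v ≠ t → ∃ e b, (e, b) ∈ D ∧ s e b = v ∧ s e (!b) = par v) ∧
      (∀ v, ∃ n, par^[n] v = t)) := by
    by_cases ho : odd
    · obtain ⟨par, D, h1, h2, h3, -⟩ := edmonds (fun p : E × Bool => s p.1 p.2)
        (fun p => s p.1 (!p.2)) t 1 C (by
          intro X ht ⟨x, hx⟩
          obtain ⟨e, b, h1, h2⟩ := h.conn ho X ht ⟨x, hx, trivial⟩
          unfold outN
          refine Nat.succ_le_of_lt (Finset.sum_pos' (fun _ _ => Nat.zero_le _)
            ⟨(e, b), Finset.mem_univ _, ?_⟩)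
          rw [if_pos ⟨h2.1, h2.2, h1⟩]
          exact one_pos)
      refine ⟨par 0, D 0, h1 0, fun _ => ⟨?_, h3 0⟩⟩
      intro v hv
      obtain ⟨⟨e, b⟩, h4, h5, h6⟩ := h2 0 v hv
      exact ⟨e, b, h4, h5, h6⟩
    · exact ⟨id, ∅, Set.empty_subset _, fun h => absurd h ho⟩
  obtain ⟨parC, D, hDC, hD⟩ := hc
  let par : ℕ → V → V := fun i => if h : i < k then parb true ⟨i, h⟩ else
    if h : i - k < k then parb false ⟨i - k, h⟩ else parC
  let P : ℕ → Set (E × Bool) := fun i => if h : i < k then {p | p.2 = true ∧ p.1 ∈ T true ⟨i, h⟩} else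
    if h : i - k < k then {p | p.2 = false ∧ p.1 ∈ T false ⟨i - k, h⟩} else D
  have par1 : ∀ i (h : i < k), par i = parb true ⟨i, h⟩ := fun i h => by simp [par, h]
  have par2 : ∀ i (h1 : ¬ i < k) (h : i - k < k), par i = parb false ⟨i - k, h⟩ :=
    fun i h1 h => by simp [par, h, h1]
  have par3 : ∀ i (_ : ¬ i < k) (_ : ¬ i - k < k), par i = parC :=
    fun i h1 h => by simp [par, h, h1]
  have P1 : ∀ i (h : i < k), P i = {p | p.2 = true ∧ p.1 ∈ T true ⟨i, h⟩} :=
    fun i h => by simp [P, h]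
  have P2 : ∀ i (h1 : ¬ i < k) (h : i - k < k), P i = {p | p.2 = false ∧ p.1 ∈ T false ⟨i - k, h⟩} :=
    fun i h1 h => by simp [P, h, h1]
  have P3 : ∀ i (_ : ¬ i < k) (_ : ¬ i - k < k), P i = D :=
    fun i h1 h => by simp [P, h, h1]
  refine ⟨par, P, ?_, ?_, ?_, ?_⟩
  · intro i hi
    by_cases h1 : i < k
    · rw [par1 i h1, P1 i h1]
      refine ⟨?_, hTr true _⟩
      intro v hv
      obtain ⟨a, h2, h3, h4⟩ := hTs true ⟨i, h1⟩ v hv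
      exact ⟨a, true, ⟨rfl, h2⟩, h3, h4⟩
    by_cases h2 : i - k < k
    · rw [par2 i h1 h2, P2 i h1 h2]
      refine ⟨?_, hTr false _⟩
      intro v hv
      obtain ⟨a, h2, h3, h4⟩ := hTs false ⟨i - k, h2⟩ v hv
      exact ⟨a, false, ⟨rfl, h2⟩, h3, h4⟩
    · rw [par3 i h1 h2, P3 i h1 h2]
      exact hD (hi.resolve_left (by omega)).1
  · have hlt : ∀ i j, i ≤ 2 * k → j ≤ 2 * k → i < j → ∀ p ∈ P i, p ∉ P j := by
      rintro i j hi hj hij ⟨e, b⟩ hp hp'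
      have hi' : i < k ∨ (¬ i < k ∧ i - k < k) := by omega
      rcases hi' with h1 | ⟨h1, h2⟩
      · rw [P1 i h1] at hp
        obtain ⟨rfl, hp⟩ := hp
        by_cases h3 : j < k
        · rw [P1 j h3] at hp'
          exact hTd true _ _ (by rw [Ne, Fin.mk.injEq]; omega) e hp hp'.2
        by_cases h4 : j - k < k
        · rw [P2 j h3 h4] at hp'
          exact absurd hp'.1 (by simp)
        · rw [P3 j h3 h4] at hp'
          exact hTC true _ hp (hDC hp')
      · rw [P2 i h1 h2] at hp
        obtain ⟨rfl, hp⟩ := hp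
        have h3 : ¬ j < k := by omega
        by_cases h4 : j - k < k
        · rw [P2 j h3 h4] at hp'
          exact hTd false _ _ (by rw [Ne, Fin.mk.injEq]; omega) e hp hp'.2
        · rw [P3 j h3 h4] at hp'
          exact hTC false _ hp (hDC hp')
    intro i j hi hj hij p hp hp'
    rcases Nat.lt_or_gt_of_ne hij with h | h
    · exact hlt i j hi hj h p hp hp'
    · exact hlt j i hj hi h p hp' hp
  · intro i hi p hp
    rw [P1 i hi] at hp
    exact hp.1
  · intro i hi hi' p hp
    rw [P2 i (by omega) (by omega)] at hp
    exact hp.1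

theorem graph_pack (G : SimpleGraph V) (t : V) (k : ℕ) (hk : 1 ≤ k) (odd : Prop) (K : ℕ)
    (hK : (¬ odd ∧ K = 2 * k) ∨ (odd ∧ K = 2 * k + 1))
    (hG : ∀ F : Set (Sym2 V), F ⊆ G.edgeSet → F.ncard ≤ K - 1 → (G.deleteEdges F).Connected) :
    ∃ (s : G.edgeSet → Bool → V) (par : ℕ → V → V) (P : ℕ → Set (G.edgeSet × Bool)),
      (∀ e b, s(s e b, s e (!b)) = e.1) ∧ Packing odd t k s par P := by
  letI : Fintype G.edgeSet := Fintype.ofFinite _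
  have hends : ∀ e : G.edgeSet, ∃ p : V × V, s(p.1, p.2) = e.1 := by
    rintro ⟨e, he⟩
    induction e using Sym2.ind with
    | _ x y => exact ⟨(x, y), rfl⟩
  choose p hp using hends
  let s₀ : G.edgeSet → Bool → V := fun e b => if b then (p e).1 else (p e).2
  have hs₀ : ∀ e b, s(s₀ e b, s₀ e (!b)) = e.1 := by
    intro e b
    cases b
    · simpa [s₀, Sym2.eq_swap] using hp e
    · simpa [s₀] using hp e
  have hconn : Conn s₀ Set.univ K := by
    rintro X ⟨x, hx, -⟩ ⟨y, -, hy⟩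
    by_contra hlt
    let S : Finset G.edgeSet := Finset.univ.filter fun e => ¬ (s₀ e true ∈ X ↔ s₀ e false ∈ X)
    let F : Set (Sym2 V) := (S.image Subtype.val : Finset (Sym2 V))
    have hF : F.ncard ≤ K - 1 := by
      have h1 : F.ncard ≤ S.card := by
        rw [Set.ncard_coe_finset]
        exact Finset.card_image_le
      have h2 : S.card = dg s₀ X := by
        rw [Finset.card_filter]
        unfold dg
        refine Finset.sum_congr rfl fun e _ => ?_
        by_cases h : (s₀ e true ∈ X ↔ s₀ e false ∈ X)
        · rw [if_pos h, if_neg (not_not.2 h)]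
        · rw [if_neg h, if_pos h]
      omega
    have hc := hG F (by
      intro e he
      obtain ⟨e', -, rfl⟩ := Finset.mem_image.1 (Finset.mem_coe.1 he)
      exact e'.2) hF
    obtain ⟨w⟩ := hc.preconnected x y
    have hstep : ∀ a b, (G.deleteEdges F).Adj a b → a ∈ X → b ∈ X := by
      intro a b hab ha
      rw [SimpleGraph.deleteEdges_adj] at hab
      by_contra hb
      apply hab.2
      refine Finset.mem_coe.2 (Finset.mem_image.2 ⟨⟨s(a, b), hab.1⟩, ?_, rfl⟩)
      refine Finset.mem_filter.2 ⟨Finset.mem_univ _, ?_⟩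
      have := hs₀ ⟨s(a, b), hab.1⟩ true
      rcases Sym2.eq_iff.1 this with ⟨h1, h2⟩ | ⟨h1, h2⟩
      · rw [Bool.not_true] at h2
        rw [h1, h2]; simp [ha, hb]
      · rw [Bool.not_true] at h2
        rw [h1, h2]; simp [ha, hb]
    have hwalk : ∀ a b, (G.deleteEdges F).Walk a b → a ∈ X → b ∈ X := by
      intro a b w
      induction w with
      | nil => exact id
      | cons hab _ ih => exact fun h => ih (hstep _ _ hab h)
    exact hy (hwalk x y w hx)
  have hclaim : Claim odd t k s₀ Set.univ := by
    rcases hK with ⟨ho, rfl⟩ | ⟨ho, rfl⟩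
    · obtain ⟨s, C, h1, h2⟩ := main_even t k hk _ s₀ Set.univ le_rfl trivial
        (fun e => Or.inr fun _ => trivial) hconn
      exact ⟨s, C, h1, h2.cut, fun h => absurd h ho⟩
    · obtain ⟨s, C, h1, h2⟩ := main_odd t k hk _ s₀ Set.univ le_rfl trivial
        (fun e => Or.inr fun _ => trivial) hconn
      exact ⟨s, C, h1, h2.cut, fun _ => h2.conn trivial⟩
  obtain ⟨s, C, heq, hsol⟩ := hclaim
  obtain ⟨par, P, hP⟩ := packing_of_sol hsol
  refine ⟨s, par, P, ?_, hP⟩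
  intro e b
  rcases heq e with h | h
  · rw [h, h]; exact hs₀ e b
  · rw [h, h]; exact hs₀ e (!b)

end pack

end ArbPack

namespace FRR

open scoped Classical

variable {V : Type*} [Fintype V] [DecidableEq V]

/-- `G` is `k`-edge-connected: removing any set of at most `k-1` edges keeps it connected. -/
def EdgeConnected (G : SimpleGraph V) (k : ℕ) : Prop :=
  ∀ F : Set (Sym2 V), F ⊆ G.edgeSet → F.ncard ≤ k - 1 → (G.deleteEdges F).Connected

/-- An arborescence of `G` rooted at `t`, given by a parent map: every node `v ≠ t`
has exactly one outgoing arc `(v, par v)`, and iterating the parent map reaches `t`. -/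
structure Arb (G : SimpleGraph V) (t : V) where
  par : V → V
  adj : ∀ v, v ≠ t → G.Adj v (par v)
  reaches : ∀ v, ∃ n : ℕ, par^[n] v = t

/-- The arc `(u, v)` belongs to the arborescence `T`. -/
def Arb.Arc {G : SimpleGraph V} {t : V} (T : Arb G t) (u v : V) : Prop :=
  u ≠ t ∧ T.par u = v

/-- Two arborescences are arc-disjoint: they share no directed arc. -/
def ArcDisjoint {G : SimpleGraph V} {t : V} (T T' : Arb G t) : Prop :=
  ∀ u v : V, ¬ (T.Arc u v ∧ T'.Arc u v)

/-- Two arborescences are edge-disjoint: no edge of `G` occurs, in either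
orientation, in both of them. -/
def EdgeDisjointArb {G : SimpleGraph V} {t : V} (T T' : Arb G t) : Prop :=
  ∀ u v : V, T.Arc u v → ¬ T'.Arc u v ∧ ¬ T'.Arc v u

/-- The arborescences obtained from a packing. -/
theorem arbs_of_packing (G : SimpleGraph V) (t : V) (k : ℕ) (odd : Prop)
    (s : G.edgeSet → Bool → V) (par : ℕ → V → V) (P : ℕ → Set (G.edgeSet × Bool))
    (hs : ∀ e b, s(s e b, s e (!b)) = e.1) (hP : ArbPack.Packing odd t k s par P) (n : ℕ)
    (hn : ∀ i < n, i < 2 * k ∨ (odd ∧ i = 2 * k)) :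
    ∃ T : Fin n → Arb G t,
      (∀ i j : Fin n, i ≠ j → ArcDisjoint (T i) (T j)) ∧
      (∀ i j : Fin n, i ≠ j → (i : ℕ) < k → (j : ℕ) < k → EdgeDisjointArb (T i) (T j)) ∧
      (∀ i j : Fin n, i ≠ j → k ≤ (i : ℕ) → (i : ℕ) < 2 * k → k ≤ (j : ℕ) → (j : ℕ) < 2 * k →
        EdgeDisjointArb (T i) (T j)) := by
  obtain ⟨h1, h2, h3, h4⟩ := hP
  have hadj : ∀ e b, G.Adj (s e b) (s e (!b)) := by
    intro e b
    rw [← SimpleGraph.mem_edgeSet, hs]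
    exact e.2
  let T : Fin n → Arb G t := fun i =>
    { par := par i
      adj := by
        intro v hv
        obtain ⟨e, b, -, h5, h6⟩ := (h1 i (hn i i.2)).1 v hv
        rw [← h5, ← h6.trans (congrArg (par i) h5.symm)]
        exact hadj e b
      reaches := (h1 i (hn i i.2)).2 }
  have harc : ∀ i u v, (T i).Arc u v → ∃ e b, (e, b) ∈ P i ∧ s e b = u ∧ s e (!b) = v := by
    rintro i u v ⟨hu, huv⟩
    obtain ⟨e, b, h5, h6, h7⟩ := (h1 i (hn i i.2)).1 u hu
    exact ⟨e, b, h5, h6, h7.trans huv⟩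
  have hle : ∀ i : Fin n, (i : ℕ) ≤ 2 * k := fun i => by
    rcases hn i i.2 with h | h <;> omega
  have hdis : ∀ i j : Fin n, i ≠ j → ∀ p ∈ P i, p ∉ P j := fun i j hij =>
    h2 i j (hle i) (hle j) (fun h => hij (Fin.ext h))
  have hA : ∀ i j : Fin n, i ≠ j → ArcDisjoint (T i) (T j) := by
    rintro i j hij u v ⟨hi, hj⟩
    obtain ⟨e, b, h5, h6, h7⟩ := harc i u v hi
    obtain ⟨e', b', h5', h6', h7'⟩ := harc j u v hj
    have hee : e = e' := Subtype.ext (by rw [← hs e b, ← hs e' b', h6, h7, h6', h7'])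
    subst hee
    rcases ArbPack.bool_cases b' b with rfl | rfl
    · exact hdis i j hij _ h5 h5'
    · exact (hadj e b).ne (h6.trans (h6'.symm))
  have hE : ∀ i j : Fin n, i ≠ j → ∀ c, (∀ p ∈ P i, p.2 = c) → (∀ p ∈ P j, p.2 = c) →
      EdgeDisjointArb (T i) (T j) := by
    intro i j hij c hci hcj u v hi
    refine ⟨fun hj => hA i j hij u v ⟨hi, hj⟩, fun hj => ?_⟩
    obtain ⟨e, b, h5, h6, h7⟩ := harc i u v hi
    obtain ⟨e', b', h5', h6', h7'⟩ := harc j v u hj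
    have hee : e = e' := Subtype.ext (by rw [← hs e b, ← hs e' b', h6, h7, h6', h7', Sym2.eq_swap])
    subst hee
    have hb : b = b' := (hci _ h5).trans (hcj _ h5').symm
    subst hb
    exact hdis i j hij _ h5 h5'
  refine ⟨T, hA, ?_, ?_⟩
  · intro i j hij hi hj
    exact hE i j hij true (h3 i hi) (h3 j hj)
  · intro i j hij hi hi' hj hj'
    exact hE i j hij false (h4 i hi hi') (h4 j hj hj')

/-- Theorem (arborescence packing, Lemmas 4 and 5 of Chiesa et al.): for every
`k ≥ 1`: (i) every finite `2k`-edge-connected graph `G` with a node `t` has `2k`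
pairwise arc-disjoint arborescences rooted at `t` whose first `k` members are
pairwise edge-disjoint and whose last `k` members are pairwise edge-disjoint;
(ii) every finite `(2k+1)`-edge-connected graph `G` with a node `t` has `2k + 1`
pairwise arc-disjoint arborescences rooted at `t` such that the first `k` members
are pairwise edge-disjoint and the next `k` members (indices `k, …, 2k - 1`) are
pairwise edge-disjoint. -/
theorem arborescence_packing (k : ℕ) (hk : 1 ≤ k) :
    (∀ (G : SimpleGraph V) (t : V), EdgeConnected G (2 * k) →
      ∃ T : Fin (2 * k) → Arb G t,
        (∀ i j : Fin (2 * k), i ≠ j → ArcDisjoint (T i) (T j)) ∧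
        (∀ i j : Fin (2 * k), i ≠ j → (i : ℕ) < k → (j : ℕ) < k →
          EdgeDisjointArb (T i) (T j)) ∧
        (∀ i j : Fin (2 * k), i ≠ j → k ≤ (i : ℕ) → k ≤ (j : ℕ) →
          EdgeDisjointArb (T i) (T j))) ∧
    (∀ (G : SimpleGraph V) (t : V), EdgeConnected G (2 * k + 1) →
      ∃ T : Fin (2 * k + 1) → Arb G t,
        (∀ i j : Fin (2 * k + 1), i ≠ j → ArcDisjoint (T i) (T j)) ∧
        (∀ i j : Fin (2 * k + 1), i ≠ j → (i : ℕ) < k → (j : ℕ) < k →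
          EdgeDisjointArb (T i) (T j)) ∧
        (∀ i j : Fin (2 * k + 1), i ≠ j → k ≤ (i : ℕ) → (i : ℕ) < 2 * k →
          k ≤ (j : ℕ) → (j : ℕ) < 2 * k → EdgeDisjointArb (T i) (T j))) := by
  constructor
  · intro G t hG
    obtain ⟨s, par, P, hs, hP⟩ := ArbPack.graph_pack G t k hk False (2 * k)
      (Or.inl ⟨id, rfl⟩) hG
    obtain ⟨T, h1, h2, h3⟩ := arbs_of_packing G t k False s par P hs hP (2 * k)
      (fun i hi => Or.inl hi)
    exact ⟨T, h1, h2, fun i j hij hi hj => h3 i j hij hi i.2 hj j.2⟩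
  · intro G t hG
    obtain ⟨s, par, P, hs, hP⟩ := ArbPack.graph_pack G t k hk True (2 * k + 1)
      (Or.inr ⟨trivial, rfl⟩) hG
    exact arbs_of_packing G t k True s par P hs hP (2 * k + 1)
      (fun i hi => by
        by_cases h : i < 2 * k
        · exact Or.inl h
        · exact Or.inr ⟨trivial, by omega⟩)

end FRR
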